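/- arXiv:2602.01499 — 2 statements merged into one kernel-verified Lean document; each statement's English description precedes it below -/
import Mathlib

section
/- Let k ∈ ℕ and let (W_{k²}, K_{W_{k²}}) be the k²×k² grid rooted at its first row. Then for every labeling γ: E(W_{k²}) → ℤ/2ℤ, the rooted signed graph (W_{k²}, γ, K_{W_{k²}}) contains the rooted grid 𝒲_k as a rooted signed graph minor. -/
namespace TDMPaper

/-- A finite multigraph without loops: edges carry their unordered pair of endpoints. -/
structure MGraph where
  V : Type
  E : Type
  finV : Finite V
  finE : Finite E
  ends : E → Sym2 V
  loopless : ∀ e, ¬ (ends e).IsDiag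

attribute [instance] MGraph.finV MGraph.finE

namespace MGraph

/-- A cycle in a multigraph, given by cyclically ordered distinct vertices and
distinct edges. -/
structure Cycle (G : MGraph) where
  n : ℕ
  npos : 0 < n
  vtx : Fin n → G.V
  edge : Fin n → G.E
  vtx_inj : Function.Injective vtx
  edge_inj : Function.Injective edge
  ends_eq : ∀ i : Fin n,
    G.ends (edge i) = s(vtx i, vtx ⟨(i.1 + 1) % n, Nat.mod_lt _ npos⟩)

/-- The parity of a cycle with respect to a signing `γ`. -/
def Cycle.parity {G : MGraph} (C : G.Cycle) (γ : G.E → ZMod 2) : ZMod 2 :=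
  ∑ i, γ (C.edge i)

/-- The vertex set of a cycle. -/
def Cycle.support {G : MGraph} (C : G.Cycle) : Set G.V := Set.range C.vtx

/-- The odd cycle packing number of a signed graph: the maximum number of pairwise
vertex-disjoint odd cycles. -/
noncomputable def OCP (G : MGraph) (γ : G.E → ZMod 2) : ℕ :=
  sSup {k : ℕ | ∃ C : Fin k → G.Cycle,
    (∀ i, (C i).parity γ = 1) ∧
    ∀ i j, i ≠ j → Disjoint ((C i).support) ((C j).support)}

/-- The subgraph induced by a vertex set `S` (kept on the same vertex type; only
edges with both endpoints in `S` survive). -/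
def induce (G : MGraph) (S : Set G.V) : MGraph where
  V := G.V
  E := {e : G.E // ∀ v ∈ G.ends e, v ∈ S}
  finV := G.finV
  finE := inferInstance
  ends := fun e => G.ends e.1
  loopless := fun e => G.loopless e.1

/-- The odd cycle packing number of the subgraph induced on `S`, signs inherited. -/
noncomputable def OCPOn (G : MGraph) (γ : G.E → ZMod 2) (S : Set G.V) : ℕ :=
  (G.induce S).OCP (fun e => γ e.1)

/-- A path in a multigraph. -/
structure Path (G : MGraph) where
  n : ℕ
  vtx : Fin (n + 1) → G.V
  edge : Fin n → G.E
  vtx_inj : Function.Injective vtx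
  ends_eq : ∀ i : Fin n, G.ends (edge i) = s(vtx i.castSucc, vtx i.succ)

def Path.first {G : MGraph} (P : G.Path) : G.V := P.vtx 0
def Path.last {G : MGraph} (P : G.Path) : G.V := P.vtx (Fin.last P.n)
def Path.support {G : MGraph} (P : G.Path) : Set G.V := Set.range P.vtx
def Path.internals {G : MGraph} (P : G.Path) : Set G.V :=
  P.support \ {P.first, P.last}
def Path.parity {G : MGraph} (P : G.Path) (γ : G.E → ZMod 2) : ZMod 2 :=
  ∑ i, γ (P.edge i)

end MGraph

open MGraph

/-- `γ'` is obtained from `γ` by a sequence of shiftings at vertices. -/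
def IsShift (G : MGraph) (γ γ' : G.E → ZMod 2) : Prop :=
  ∃ σ : G.V → ZMod 2, ∀ e u v, G.ends e = s(u, v) → γ' e = γ e + σ u + σ v

/-- A minor model of `H` in `G`: disjoint nonempty connected branch sets and an
injective assignment of edges. -/
structure MinorModel (H G : MGraph) where
  bs : H.V → Set G.V
  em : H.E → G.E
  bs_nonempty : ∀ v, (bs v).Nonempty
  bs_disjoint : ∀ u v, u ≠ v → Disjoint (bs u) (bs v)
  bs_connected : ∀ v, ∀ a ∈ bs v, ∀ b ∈ bs v,
    Relation.ReflTransGen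
      (fun x y => x ∈ bs v ∧ y ∈ bs v ∧ ∃ e, G.ends e = s(x, y)) a b
  em_inj : Function.Injective em
  em_ends : ∀ eH u v, H.ends eH = s(u, v) →
    ∃ a ∈ bs u, ∃ b ∈ bs v, G.ends (em eH) = s(a, b)

/-- `H` is a minor of `G`. -/
def IsMinor (H G : MGraph) : Prop := Nonempty (MinorModel H G)

/-- `(H,KH)` is a rooted minor of `(G,KG)`: there is a minor model in which the
branch set of every root of `H` contains a root of `G`. -/
def IsRootedMinor (H : MGraph) (KH : Set H.V) (G : MGraph) (KG : Set G.V) : Prop :=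
  ∃ M : MinorModel H G, ∀ v ∈ KH, (M.bs v ∩ KG).Nonempty

/-- A signed minor model of `(H,γH)` in `(G,γG)`: after shifting, branch sets are
connected through even edges and edges of `H` get edges of `G` of the correct sign. -/
structure SignedMinorModel (H G : MGraph) (γH : H.E → ZMod 2) (γG : G.E → ZMod 2) where
  γ' : G.E → ZMod 2
  shift : IsShift G γG γ'
  bs : H.V → Set G.V
  em : H.E → G.E
  bs_nonempty : ∀ v, (bs v).Nonempty
  bs_disjoint : ∀ u v, u ≠ v → Disjoint (bs u) (bs v)
  bs_connected : ∀ v, ∀ a ∈ bs v, ∀ b ∈ bs v,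
    Relation.ReflTransGen
      (fun x y => x ∈ bs v ∧ y ∈ bs v ∧ ∃ e, γ' e = 0 ∧ G.ends e = s(x, y)) a b
  em_inj : Function.Injective em
  em_ends : ∀ eH u v, H.ends eH = s(u, v) →
    ∃ a ∈ bs u, ∃ b ∈ bs v, G.ends (em eH) = s(a, b)
  em_parity : ∀ eH, γ' (em eH) = γH eH

/-- `(H,γH)` is a signed graph minor of `(G,γG)`. -/
def IsSignedMinor (H : MGraph) (γH : H.E → ZMod 2) (G : MGraph)
    (γG : G.E → ZMod 2) : Prop :=
  Nonempty (SignedMinorModel H G γH γG)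

/-- `(H,γH,KH)` is a rooted signed graph minor of `(G,γG,KG)`. -/
def IsRootedSignedMinor (H : MGraph) (γH : H.E → ZMod 2) (KH : Set H.V)
    (G : MGraph) (γG : G.E → ZMod 2) (KG : Set G.V) : Prop :=
  ∃ M : SignedMinorModel H G γH γG, ∀ v ∈ KH, (M.bs v ∩ KG).Nonempty

/-- An odd minor model of `H` in `G`: a minor model together with a 2-colouring of
`G` which is proper on each branch set (branch sets are connected through
bichromatic edges) and for which every model edge is monochromatic. -/
structure OddMinorModel (H G : MGraph) where
  bs : H.V → Set G.V
  em : H.E → G.E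
  col : G.V → ZMod 2
  bs_nonempty : ∀ v, (bs v).Nonempty
  bs_disjoint : ∀ u v, u ≠ v → Disjoint (bs u) (bs v)
  bs_connected : ∀ v, ∀ a ∈ bs v, ∀ b ∈ bs v,
    Relation.ReflTransGen
      (fun x y => x ∈ bs v ∧ y ∈ bs v ∧ col x ≠ col y ∧ ∃ e, G.ends e = s(x, y)) a b
  em_inj : Function.Injective em
  em_ends : ∀ eH u v, H.ends eH = s(u, v) →
    ∃ a ∈ bs u, ∃ b ∈ bs v, G.ends (em eH) = s(a, b)
  em_mono : ∀ eH u v, G.ends (em eH) = s(u, v) → col u = col v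

/-- `G` contains `H` as an odd-minor. -/
def IsOddMinor (H G : MGraph) : Prop := Nonempty (OddMinorModel H G)

/-- `(G,γG)` contains `(H,γH)` as a subdivision. -/
def IsSignedSubdivision (H : MGraph) (γH : H.E → ZMod 2) (G : MGraph)
    (γG : G.E → ZMod 2) : Prop :=
  ∃ (γH' : H.E → ZMod 2) (_ : IsShift H γH γH')
    (φV : H.V → G.V) (φE : H.E → G.Path),
    Function.Injective φV ∧
    (∀ eH u v, H.ends eH = s(u, v) →
      s((φE eH).first, (φE eH).last) = s(φV u, φV v)) ∧
    (∀ eH, (φE eH).parity γG = γH' eH) ∧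
    (∀ e e', e ≠ e' → Disjoint ((φE e).internals) ((φE e').support)) ∧
    (∀ e, Disjoint ((φE e).internals) (Set.range φV))

/-! ## Tree decompositions and width parameters -/

/-- A tree decomposition of a multigraph. -/
structure TreeDecomp (G : MGraph) where
  ι : Type
  tree : SimpleGraph ι
  isTree : tree.IsTree
  bag : ι → Set G.V
  covers_vertex : ∀ v, ∃ t, v ∈ bag t
  covers_edge : ∀ e, ∃ t, ∀ v ∈ G.ends e, v ∈ bag t
  bag_connected : ∀ v, (tree.induce {t | v ∈ bag t}).Connected

/-- A node of a tree is a leaf if it has at most one neighbour. -/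
def IsLeaf {ι : Type} (T : SimpleGraph ι) (t : ι) : Prop :=
  (T.neighborSet t).Subsingleton

/-- A tree `K`-free-decomposition. -/
structure KFreeDecomp (G : MGraph) (K : Set G.V) extends TreeDecomp G where
  L : Set G.V
  L_disj : Disjoint L K
  unique_bag : ∀ v ∈ L, ∃! t, v ∈ bag t
  leaf_bag : ∀ v ∈ L, ∀ t, v ∈ bag t → IsLeaf tree t

/-- The width of a tree `K`-free-decomposition: `max {0, max_t |β(t)\L| - 1}`. -/
noncomputable def KFreeDecomp.width {G : MGraph} {K : Set G.V}
    (D : KFreeDecomp G K) : ℕ :=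
  ⨆ t : D.ι, ((D.bag t \ D.L).ncard - 1)

/-- The `K`-free treewidth of `(G,K)`. -/
noncomputable def twK (G : MGraph) (K : Set G.V) : ℕ :=
  sInf {w | ∃ D : KFreeDecomp G K, D.width = w}

/-- A tame OCP-tree-decomposition of a signed graph. -/
structure TameOCPDecomp (G : MGraph) (γ : G.E → ZMod 2) extends TreeDecomp G where
  prot : ι → Set G.V
  prot_sub : ∀ t, prot t ⊆ bag t
  prot_adh : ∀ t t', tree.Adj t t' → ((bag t ∩ bag t') \ prot t).ncard ≤ 1

/-- The tame width (t-width) of a tame OCP-tree-decomposition. -/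
noncomputable def TameOCPDecomp.twidth {G : MGraph} {γ : G.E → ZMod 2}
    (D : TameOCPDecomp G γ) : ℕ :=
  ⨆ t : D.ι, ((D.prot t).ncard + G.OCPOn γ (D.bag t \ D.prot t))

/-- The tame OCP-treewidth of a signed graph. -/
noncomputable def tOCPtw (G : MGraph) (γ : G.E → ZMod 2) : ℕ :=
  sInf {w | ∃ D : TameOCPDecomp G γ, D.twidth = w}

/-- A TDM-tree-decomposition of a rooted signed graph. -/
structure TDMDecomp (G : MGraph) (γ : G.E → ZMod 2) (K : Set G.V)
    extends TreeDecomp G where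
  prot : ι → Set G.V
  J : Set ι
  J_subtree : J.Nonempty → (tree.induce J).Connected
  prot_sub : ∀ t, prot t ⊆ bag t
  prot_roots : ∀ t, K ∩ bag t ⊆ prot t
  prot_adh : ∀ t t', tree.Adj t t' → ((bag t ∩ bag t') \ prot t).ncard ≤ 1
  strong : ∀ t ∈ J, ∀ t', tree.Adj t t' → bag t ∩ bag t' ⊆ prot t
  roots_in_J : K ⊆ ⋃ j ∈ J, bag j

/-- The width of a TDM-tree-decomposition. -/
noncomputable def TDMDecomp.width {G : MGraph} {γ : G.E → ZMod 2} {K : Set G.V}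
    (D : TDMDecomp G γ K) : ℕ :=
  ⨆ t : D.ι, ((D.prot t).ncard + G.OCPOn γ (D.bag t \ D.prot t))

/-- The TDM-treewidth of a rooted signed graph. -/
noncomputable def TDMtw (G : MGraph) (γ : G.E → ZMod 2) (K : Set G.V) : ℕ :=
  sInf {w | ∃ D : TDMDecomp G γ K, D.width = w}

/-! ## Grids, parity handles, parity vortices -/

/-- Adjacency of the grid, on `ℕ × ℕ` coordinates. -/
def gridAdj (a b : ℕ × ℕ) : Prop :=
  (a.1 = b.1 ∧ (a.2 + 1 = b.2 ∨ b.2 + 1 = a.2)) ∨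
  (a.2 = b.2 ∧ (a.1 + 1 = b.1 ∨ b.1 + 1 = a.1))

/-- The `k × k` grid. -/
def gridGraph (k : ℕ) : MGraph where
  V := Fin k × Fin k
  E := {e : Sym2 (Fin k × Fin k) //
    ∃ a b : Fin k × Fin k, gridAdj (a.1.1, a.2.1) (b.1.1, b.2.1) ∧ e = s(a, b)}
  finV := inferInstance
  finE := inferInstance
  ends := Subtype.val
  loopless := fun e he => by
    obtain ⟨a, b, hab, h⟩ := e.2
    rw [h, Sym2.mk_isDiag_iff] at he
    subst he
    rcases hab with ⟨_, h' | h'⟩ | ⟨_, h' | h'⟩ <;> omega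

/-- The first row of the `k × k` grid. -/
def firstRow (k : ℕ) : Set (gridGraph k).V := {p : Fin k × Fin k | p.1.1 = 0}

/-- The `i`-th designated vertex `x_i` on the outer face of the cylindrical
`(k × 4k)`-grid (every other vertex, `0`-indexed). -/
def xvtx (k : ℕ) (i : Fin (2 * k)) : Fin k × Fin (4 * k) :=
  (⟨0, by have := i.2; omega⟩, ⟨2 * i.1, by have := i.2; omega⟩)

/-- Adjacency of the cylindrical `(k × 4k)`-grid `P_k □ C_{4k}`. -/
def cylAdj (k : ℕ) (a b : Fin k × Fin (4 * k)) : Prop :=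
  (a.1 = b.1 ∧ (a.2.1 + 1 = b.2.1 ∨ b.2.1 + 1 = a.2.1 ∨
    (a.2.1 = 0 ∧ b.2.1 + 1 = 4 * k) ∨ (b.2.1 = 0 ∧ a.2.1 + 1 = 4 * k))) ∨
  (a.2 = b.2 ∧ (a.1.1 + 1 = b.1.1 ∨ b.1.1 + 1 = a.1.1))

/-- The chords `x_i x_{2k-i+1}` of the parity handle. -/
def handleChord (k : ℕ) (e : Sym2 (Fin k × Fin (4 * k))) : Prop :=
  ∃ i : Fin k, e = s(xvtx k ⟨i.1, by have := i.2; omega⟩,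
    xvtx k ⟨2 * k - 1 - i.1, by have := i.2; omega⟩)

/-- The chords `x_{2i-1} x_{2i}` of the parity vortex. -/
def vortexChord (k : ℕ) (e : Sym2 (Fin k × Fin (4 * k))) : Prop :=
  ∃ i : Fin k, e = s(xvtx k ⟨2 * i.1, by have := i.2; omega⟩,
    xvtx k ⟨2 * i.1 + 1, by have := i.2; omega⟩)

lemma xvtx_ne (k : ℕ) (i j : Fin (2 * k)) (h : i.1 ≠ j.1) : xvtx k i ≠ xvtx k j := by
  intro hc
  have := congrArg (fun p => p.2.1) hc
  simp only [xvtx] at this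
  omega

/-- The unsigned, unrooted parity handle `H_k`. -/
def handleGraph (k : ℕ) : MGraph where
  V := Fin k × Fin (4 * k)
  E := {e : Sym2 (Fin k × Fin (4 * k)) //
    (∃ a b, cylAdj k a b ∧ e = s(a, b)) ∨ handleChord k e}
  finV := inferInstance
  finE := inferInstance
  ends := Subtype.val
  loopless := fun e he => by
    rcases e.2 with ⟨a, b, hab, h⟩ | ⟨i, h⟩
    · rw [h, Sym2.mk_isDiag_iff] at he
      subst he
      have h1 := a.1.2
      have h2 := a.2.2
      rcases hab with ⟨_, h' | h' | ⟨h', h''⟩ | ⟨h', h''⟩⟩ | ⟨_, h' | h'⟩ <;> omega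
    · rw [h, Sym2.mk_isDiag_iff] at he
      have := i.2
      exact xvtx_ne k _ _ (show (i.1 : ℕ) ≠ 2 * k - 1 - i.1 by omega) he

/-- The unsigned, unrooted parity vortex `V_k`. -/
def vortexGraph (k : ℕ) : MGraph where
  V := Fin k × Fin (4 * k)
  E := {e : Sym2 (Fin k × Fin (4 * k)) //
    (∃ a b, cylAdj k a b ∧ e = s(a, b)) ∨ vortexChord k e}
  finV := inferInstance
  finE := inferInstance
  ends := Subtype.val
  loopless := fun e he => by
    rcases e.2 with ⟨a, b, hab, h⟩ | ⟨i, h⟩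
    · rw [h, Sym2.mk_isDiag_iff] at he
      subst he
      have h1 := a.1.2
      have h2 := a.2.2
      rcases hab with ⟨_, h' | h' | ⟨h', h''⟩ | ⟨h', h''⟩⟩ | ⟨_, h' | h'⟩ <;> omega
    · rw [h, Sym2.mk_isDiag_iff] at he
      have := i.2
      exact xvtx_ne k _ _ (show (2 * i.1 : ℕ) ≠ 2 * i.1 + 1 by omega) he

/-- The all-zero signing. -/
def γ₀ (G : MGraph) : G.E → ZMod 2 := fun _ => 0

/-- The all-one signing. -/
def γ₁ (G : MGraph) : G.E → ZMod 2 := fun _ => 1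

/-! ## Matrices with two nonzero entries per row -/

/-- `A` has exactly two nonzero entries in every row. -/
def TwoNonzeroPerRow {m n : ℕ} (A : Matrix (Fin m) (Fin n) ℤ) : Prop :=
  ∀ i, {j | A i j ≠ 0}.ncard = 2

/-- The graph `G(A)` of a matrix with exactly two nonzero entries per row:
vertices are columns, edges are rows, each row joining its two nonzero columns. -/
noncomputable def matrixGraph {m n : ℕ} (A : Matrix (Fin m) (Fin n) ℤ)
    (h : TwoNonzeroPerRow A) : MGraph where
  V := Fin n
  E := Fin m
  finV := inferInstance
  finE := inferInstance
  ends := fun i => s((Set.ncard_eq_two.mp (h i)).choose,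
    (Set.ncard_eq_two.mp (h i)).choose_spec.choose)
  loopless := fun i hi => by
    rw [Sym2.mk_isDiag_iff] at hi
    exact (Set.ncard_eq_two.mp (h i)).choose_spec.choose_spec.1 hi

/-- The signing of `G(A)`: a row is even iff its two nonzero entries have
different signs (i.e. the product of its nonzero entries is negative). -/
def matrixSign {m n : ℕ} (A : Matrix (Fin m) (Fin n) ℤ) : Fin m → ZMod 2 :=
  fun i => if (∏ j ∈ Finset.univ.filter (fun j => A i j ≠ 0), A i j) < 0 then 0 else 1

/-- The roots of `G⁺_•(A)`: columns containing an entry outside `{-1,0,1}`. -/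
def matrixRoots {m n : ℕ} (A : Matrix (Fin m) (Fin n) ℤ) : Set (Fin n) :=
  {j | ∃ i, 1 < (A i j).natAbs}

/-- The TDM-treewidth of the rooted signed graph `G⁺_•(A)` associated to `A`. -/
noncomputable def matrixTDMtw {m n : ℕ} (A : Matrix (Fin m) (Fin n) ℤ)
    (h : TwoNonzeroPerRow A) : ℕ :=
  TDMtw (matrixGraph A h) (fun e => matrixSign A e) (fun j => matrixRoots A j)

/-- The largest absolute value of an entry of `A`. -/
def maxAbsEntry {m n : ℕ} (A : Matrix (Fin m) (Fin n) ℤ) : ℕ :=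
  Finset.sup Finset.univ fun i => Finset.sup Finset.univ fun j => (A i j).natAbs

/-- `A` is totally `Δ`-modular: every square subdeterminant has absolute value at
most `Δ`. -/
def TotallyDeltaModular {m n : ℕ} (A : Matrix (Fin m) (Fin n) ℤ) (Δ : ℕ) : Prop :=
  ∀ (s : ℕ) (r : Fin s → Fin m) (c : Fin s → Fin n),
    Function.Injective r → Function.Injective c →
    ((A.submatrix r c).det).natAbs ≤ Δ

/-- The set of objective values of feasible points of the integer program
`max { wᵀx : Ax ≤ b, ℓ ≤ x ≤ u, x integral }`. -/
def IPvalues {m n : ℕ} (A : Matrix (Fin m) (Fin n) ℤ) (b : Fin m → ℤ)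
    (w ℓ u : Fin n → ℤ) : Set ℤ :=
  {y | ∃ x : Fin n → ℤ, (∀ i, ∑ j, A i j * x j ≤ b i) ∧
    (∀ j, ℓ j ≤ x j ∧ x j ≤ u j) ∧ y = ∑ j, w j * x j}

/-- `o` solves the maximization problem over `S`: it is `none` iff `S` is
infeasible, and otherwise it is the maximum value. -/
def SolvesIP (o : Option ℤ) (S : Set ℤ) : Prop :=
  (o = none ∧ S = ∅) ∨ ∃ y, o = some y ∧ IsGreatest S y


lemma exists_pair {α : Type} (z : Sym2 α) : ∃ p : α × α, z = s(p.1, p.2) :=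
  Sym2.ind (fun a b => ⟨(a, b), rfl⟩) z

/-- A chosen first endpoint of an edge. -/
noncomputable def MGraph.ep1 (G : MGraph) (e : G.E) : G.V :=
  (exists_pair (G.ends e)).choose.1

/-- A chosen second endpoint of an edge. -/
noncomputable def MGraph.ep2 (G : MGraph) (e : G.E) : G.V :=
  (exists_pair (G.ends e)).choose.2

lemma MGraph.ends_ep (G : MGraph) (e : G.E) : G.ends e = s(G.ep1 e, G.ep2 e) :=
  (exists_pair (G.ends e)).choose_spec

lemma map_inl_not_isDiag {α β : Type} (z : Sym2 α) (hz : ¬ z.IsDiag) :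
    ¬ (z.map (Sum.inl : α → α ⊕ β)).IsDiag := by
  induction z using Sym2.ind with
  | _ a b =>
    simp only [Sym2.map_pair_eq, Sym2.mk_isDiag_iff] at *
    exact fun h => hz (by injection h)

/-- The graph obtained from `(G,γ)` by subdividing every even edge exactly once. -/
noncomputable def subdivideEven (G : MGraph) (γ : G.E → ZMod 2) : MGraph where
  V := G.V ⊕ {e : G.E // γ e = 0}
  E := {e : G.E // γ e ≠ 0} ⊕ ({e : G.E // γ e = 0} × Bool)
  finV := inferInstance
  finE := inferInstance
  ends := fun x =>
    match x with
    | .inl e => (G.ends e.1).map .inl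
    | .inr (e, b) => s(.inr e, .inl (if b then G.ep1 e.1 else G.ep2 e.1))
  loopless := fun x => by
    match x with
    | .inl e => exact map_inl_not_isDiag _ (G.loopless e.1)
    | .inr (e, b) =>
      rw [Sym2.mk_isDiag_iff]
      simp

/-- Minimum degree at least `d` (each vertex is incident to at least `d` edges). -/
def minDegreeGE (G : MGraph) (d : ℕ) : Prop :=
  ∀ v : G.V, d ≤ {e : G.E | v ∈ G.ends e}.ncard

/-- The `j`-th vertex of the subdividing path: `u`, then `ℓ` new internal
vertices, then `v`. -/
def pathVert {α : Type} (u v : α) (ℓ : ℕ) (j : Fin (ℓ + 2)) : α ⊕ Fin ℓ :=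
  if h0 : j.1 = 0 then .inl u
  else if h1 : j.1 = ℓ + 1 then .inl v
  else .inr ⟨j.1 - 1, by have := j.2; omega⟩

/-- The graph obtained from `G` by replacing the edge `e₀` (with ends `u,v`) by a
path with `ℓ` internal vertices (hence `ℓ + 1` edges). -/
def replaceEdge (G : MGraph) (e₀ : G.E) (u v : G.V) (h : G.ends e₀ = s(u, v))
    (ℓ : ℕ) : MGraph where
  V := G.V ⊕ Fin ℓ
  E := {e : G.E // e ≠ e₀} ⊕ Fin (ℓ + 1)
  finV := inferInstance
  finE := inferInstance
  ends := fun x =>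
    match x with
    | .inl e => (G.ends e.1).map .inl
    | .inr i => s(pathVert u v ℓ ⟨i.1, by have := i.2; omega⟩,
        pathVert u v ℓ ⟨i.1 + 1, by have := i.2; omega⟩)
  loopless := fun x => by
    match x with
    | .inl e => exact map_inl_not_isDiag _ (G.loopless e.1)
    | .inr i =>
      rw [Sym2.mk_isDiag_iff]
      have huv : u ≠ v := by
        intro hc
        exact G.loopless e₀ (by rw [h, hc]; simp)
      have hi := i.2
      simp only [pathVert]
      split_ifs <;> (simp_all; try omega)

/-- The signing of `replaceEdge`: old edges keep their sign, the `i`-th path edge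
gets sign `δ i`. -/
def replaceGamma {G : MGraph} {e₀ : G.E} {u v : G.V} {h : G.ends e₀ = s(u, v)}
    {ℓ : ℕ} (γ : G.E → ZMod 2) (δ : Fin (ℓ + 1) → ZMod 2) :
    (replaceEdge G e₀ u v h ℓ).E → ZMod 2 :=
  fun x => match x with
  | .inl e => γ e.1
  | .inr i => δ i


/-! ## Proof -/

/-- Label of the horizontal edge `(r,c)-(r,c+1)`. -/
noncomputable def hLab (n : ℕ) (γ : (gridGraph n).E → ZMod 2) (r c : ℕ) : ZMod 2 :=
  if h : r < n ∧ c + 1 < n then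
    γ ⟨s((⟨r, h.1⟩, ⟨c, by omega⟩), (⟨r, h.1⟩, ⟨c + 1, h.2⟩)),
      (⟨r, h.1⟩, ⟨c, by omega⟩), (⟨r, h.1⟩, ⟨c + 1, h.2⟩), Or.inl ⟨rfl, Or.inl rfl⟩, rfl⟩
  else 0

/-- Label of the vertical edge `(r,c)-(r+1,c)`. -/
noncomputable def vLab (n : ℕ) (γ : (gridGraph n).E → ZMod 2) (r c : ℕ) : ZMod 2 :=
  if h : r + 1 < n ∧ c < n then
    γ ⟨s((⟨r, by omega⟩, ⟨c, h.2⟩), (⟨r + 1, h.1⟩, ⟨c, h.2⟩)),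
      (⟨r, by omega⟩, ⟨c, h.2⟩), (⟨r + 1, h.1⟩, ⟨c, h.2⟩), Or.inr ⟨rfl, Or.inl rfl⟩, rfl⟩
  else 0

/-- `p` and `q` are joined by an edge which is even after shifting by `σ`. -/
def Ev (n : ℕ) (γ : (gridGraph n).E → ZMod 2) (σ : ℕ × ℕ → ZMod 2) (p q : ℕ × ℕ) : Prop :=
  ∃ (e : (gridGraph n).E) (a b : Fin n × Fin n), (gridGraph n).ends e = s(a, b) ∧
    (a.1.1, a.2.1) = p ∧ (b.1.1, b.2.1) = q ∧ γ e + σ p + σ q = 0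

lemma Ev.symm {n : ℕ} {γ : (gridGraph n).E → ZMod 2} {σ : ℕ × ℕ → ZMod 2} {p q : ℕ × ℕ}
    (h : Ev n γ σ p q) : Ev n γ σ q p := by
  obtain ⟨e, a, b, h1, h2, h3, h4⟩ := h
  exact ⟨e, b, a, by rw [h1, Sym2.eq_swap], h3, h2, by rw [← h4]; ring⟩

lemma Ev.congr {n : ℕ} {γ : (gridGraph n).E → ZMod 2} {σ σ' : ℕ × ℕ → ZMod 2} {p q : ℕ × ℕ}
    (h : Ev n γ σ p q) (hp : σ' p = σ p) (hq : σ' q = σ q) : Ev n γ σ' p q := by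
  obtain ⟨e, a, b, h1, h2, h3, h4⟩ := h
  exact ⟨e, a, b, h1, h2, h3, by rw [hp, hq, h4]⟩

lemma Ev.right {n : ℕ} {γ : (gridGraph n).E → ZMod 2} {σ : ℕ × ℕ → ZMod 2} {r c : ℕ}
    (hr : r < n) (hc : c + 1 < n) (h : hLab n γ r c + σ (r, c) + σ (r, c + 1) = 0) :
    Ev n γ σ (r, c) (r, c + 1) := by
  rw [hLab, dif_pos ⟨hr, hc⟩] at h
  exact ⟨_, _, _, rfl, rfl, rfl, h⟩

lemma Ev.down {n : ℕ} {γ : (gridGraph n).E → ZMod 2} {σ : ℕ × ℕ → ZMod 2} {r c : ℕ}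
    (hr : r + 1 < n) (hc : c < n) (h : vLab n γ r c + σ (r, c) + σ (r + 1, c) = 0) :
    Ev n γ σ (r, c) (r + 1, c) := by
  rw [vLab, dif_pos ⟨hr, hc⟩] at h
  exact ⟨_, _, _, rfl, rfl, rfl, h⟩

/-- Adjacency inside `S` through even edges. -/
def Step (n : ℕ) (γ : (gridGraph n).E → ZMod 2) (σ : ℕ × ℕ → ZMod 2) (S : Set (ℕ × ℕ))
    (p q : ℕ × ℕ) : Prop := p ∈ S ∧ q ∈ S ∧ Ev n γ σ p q

lemma Step.symm {n : ℕ} {γ : (gridGraph n).E → ZMod 2} {σ : ℕ × ℕ → ZMod 2}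
    {S : Set (ℕ × ℕ)} {p q : ℕ × ℕ} (h : Step n γ σ S p q) : Step n γ σ S q p :=
  ⟨h.2.1, h.1, h.2.2.symm⟩

/-- Criterion for the even grid to be a rooted minor, in natural number coordinates. -/
lemma core (k n : ℕ) (γ : (gridGraph n).E → ZMod 2) (σ : ℕ × ℕ → ZMod 2)
    (B : ℕ → ℕ → Set (ℕ × ℕ))
    (inb : ∀ a b, a < k → b < k → ∀ p ∈ B a b, p.1 < n ∧ p.2 < n)
    (disj : ∀ a b a' b', a < k → b < k → a' < k → b' < k → ∀ p ∈ B a b, p ∈ B a' b' →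
      a = a' ∧ b = b')
    (base : ∀ a b, a < k → b < k → ∃ p ∈ B a b, ∀ q ∈ B a b,
      Relation.ReflTransGen (Step n γ σ (B a b)) q p)
    (root : ∀ b, b < k → ∃ c, (0, c) ∈ B 0 b)
    (right : ∀ a b, a < k → b + 1 < k → ∃ p ∈ B a b, ∃ q ∈ B a (b + 1), Ev n γ σ p q)
    (down : ∀ a b, a + 1 < k → b < k → ∃ p ∈ B a b, ∃ q ∈ B (a + 1) b, Ev n γ σ p q) :
    IsRootedSignedMinor (gridGraph k) (γ₀ (gridGraph k)) (firstRow k)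
      (gridGraph n) γ (firstRow n) := by
  classical
  let σ' : Fin n × Fin n → ZMod 2 := fun a => σ (a.1.1, a.2.1)
  let γ' : (gridGraph n).E → ZMod 2 := fun e =>
    γ e + σ' ((gridGraph n).ep1 e) + σ' ((gridGraph n).ep2 e)
  have hγ' : ∀ e (u v : Fin n × Fin n), (gridGraph n).ends e = s(u, v) →
      γ' e = γ e + σ' u + σ' v := by
    intro e u v h
    have h2 := (gridGraph n).ends_ep e
    rw [h] at h2
    rcases Sym2.eq_iff.1 h2 with ⟨h3, h4⟩ | ⟨h3, h4⟩
    · simp only [γ']; rw [← h3, ← h4]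
    · simp only [γ']; rw [← h3, ← h4]; ring
  let bs : Fin k × Fin k → Set (Fin n × Fin n) := fun u =>
    {x | (x.1.1, x.2.1) ∈ B u.1.1 u.2.1}
  have edge0 : ∀ u v : Fin k × Fin k, gridAdj (u.1.1, u.2.1) (v.1.1, v.2.1) →
      ∃ p ∈ B u.1.1 u.2.1, ∃ q ∈ B v.1.1 v.2.1, Ev n γ σ p q := by
    rintro ⟨⟨a, ha⟩, ⟨b, hb⟩⟩ ⟨⟨a', ha'⟩, ⟨b', hb'⟩⟩ huv
    simp only [gridAdj] at huv ⊢
    rcases huv with ⟨rfl, rfl | rfl⟩ | ⟨rfl, rfl | rfl⟩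
    · exact right _ _ ha hb'
    · obtain ⟨p, hp, q, hq, h⟩ := right _ _ ha hb
      exact ⟨q, hq, p, hp, h.symm⟩
    · exact down _ _ ha' hb
    · obtain ⟨p, hp, q, hq, h⟩ := down _ _ ha hb
      exact ⟨q, hq, p, hp, h.symm⟩
  have edge1 : ∀ eH : (gridGraph k).E, ∃ (u v : Fin k × Fin k) (e : (gridGraph n).E)
      (a b : Fin n × Fin n), (gridGraph k).ends eH = s(u, v) ∧ a ∈ bs u ∧ b ∈ bs v ∧
      (gridGraph n).ends e = s(a, b) ∧ γ' e = 0 := by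
    intro eH
    obtain ⟨u, v, huv, he⟩ := eH.2
    obtain ⟨p, hp, q, hq, e, a, b, h1, rfl, rfl, h4⟩ := edge0 u v huv
    exact ⟨u, v, e, a, b, he, hp, hq, h1, by rw [hγ' e a b h1]; exact h4⟩
  choose fu fv fe fa fb hE ha hb hab hz using edge1
  have bdisj : ∀ u v x, x ∈ bs u → x ∈ bs v → u = v := by
    intro u v x hx hy
    obtain ⟨h1, h2⟩ := disj _ _ _ _ u.1.2 u.2.2 v.1.2 v.2.2 _ hx hy
    exact Prod.ext (Fin.ext h1) (Fin.ext h2)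
  have lift : ∀ (u : Fin k × Fin k) (p q : ℕ × ℕ),
      Relation.ReflTransGen (Step n γ σ (B u.1.1 u.2.1)) p q →
      ∀ a b : Fin n × Fin n, (a.1.1, a.2.1) = p → (b.1.1, b.2.1) = q →
      Relation.ReflTransGen (fun x y => x ∈ bs u ∧ y ∈ bs u ∧
        ∃ e, γ' e = 0 ∧ (gridGraph n).ends e = s(x, y)) a b := by
    intro u p q h
    induction h with
    | refl =>
      rintro a b h1 h2
      rw [← h2, Prod.mk.injEq] at h1
      have : a = b := Prod.ext (Fin.ext h1.1) (Fin.ext h1.2)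
      rw [this]
    | tail _ hst ih =>
      rintro a b h1 h2
      obtain ⟨hS, hS', e, x, y, h3, rfl, h5, h6⟩ := hst
      refine (ih a x h1 rfl).tail ⟨hS, ?_, e, ?_, ?_⟩
      · subst h2; exact hS'
      · rw [hγ' e x y h3]
        rw [← h5] at h6
        exact h6
      · have : y = b := by
          rw [← h2, Prod.mk.injEq] at h5
          exact Prod.ext (Fin.ext h5.1) (Fin.ext h5.2)
        rw [h3, this]
  refine ⟨{ γ' := γ', shift := ⟨σ', fun e u v h => hγ' e u v h⟩, bs := bs, em := fe,
            bs_nonempty := ?_, bs_disjoint := ?_, bs_connected := ?_, em_inj := ?_,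
            em_ends := ?_, em_parity := fun e => hz e }, ?_⟩
  · intro u
    obtain ⟨p, hp, -⟩ := base _ _ u.1.2 u.2.2
    obtain ⟨h1, h2⟩ := inb _ _ u.1.2 u.2.2 p hp
    exact ⟨(⟨p.1, h1⟩, ⟨p.2, h2⟩), hp⟩
  · intro u v huv
    exact Set.disjoint_left.2 fun x hx hy => huv (bdisj u v x hx hy)
  · intro u a ha b hb
    obtain ⟨p, hp, hall⟩ := base _ _ u.1.2 u.2.2
    have h1 := hall _ ha
    have h2 := hall _ hb
    have hsym : ∀ {p q}, Relation.ReflTransGen (Step n γ σ (B u.1.1 u.2.1)) p q →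
        Relation.ReflTransGen (Step n γ σ (B u.1.1 u.2.1)) q p := by
      intro p q h
      induction h with
      | refl => exact .refl
      | tail _ hst ih => exact .head hst.symm ih
    have h3 := h1.trans (hsym h2)
    exact lift u _ _ h3 a b rfl rfl
  · intro e1 e2 h
    apply Subtype.ext
    change (gridGraph k).ends e1 = (gridGraph k).ends e2
    have h1 := hab e1
    rw [h, hab e2] at h1
    rw [hE e1, hE e2]
    rcases Sym2.eq_iff.1 h1 with ⟨h3, h4⟩ | ⟨h3, h4⟩
    · rw [bdisj (fu e1) (fu e2) _ (ha e1) (h3 ▸ ha e2),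
        bdisj (fv e1) (fv e2) _ (hb e1) (h4 ▸ hb e2)]
    · rw [bdisj (fu e1) (fv e2) _ (ha e1) (h4 ▸ hb e2),
        bdisj (fv e1) (fu e2) _ (hb e1) (h3 ▸ ha e2), Sym2.eq_swap]
  · intro e u v h
    rw [hE e] at h
    rcases Sym2.eq_iff.1 h with ⟨h3, h4⟩ | ⟨h3, h4⟩
    · exact ⟨_, h3 ▸ ha e, _, h4 ▸ hb e, hab e⟩
    · exact ⟨_, h4 ▸ hb e, _, h3 ▸ ha e, (hab e).trans Sym2.eq_swap⟩
  · rintro ⟨⟨i, hi⟩, ⟨b, hb⟩⟩ hv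
    change i = 0 at hv
    subst hv
    obtain ⟨c, hc⟩ := root b hb
    obtain ⟨h1, h2⟩ := inb _ _ hi hb _ hc
    exact ⟨(⟨0, h1⟩, ⟨c, h2⟩), hc, rfl⟩

/-- Column potential. -/
noncomputable def tau (n : ℕ) (γ : (gridGraph n).E → ZMod 2) (c r : ℕ) : ZMod 2 :=
  ∑ x ∈ Finset.range r, vLab n γ x c

lemma tau_succ (n : ℕ) (γ : (gridGraph n).E → ZMod 2) (c r : ℕ) :
    tau n γ c (r + 1) = tau n γ c r + vLab n γ r c := Finset.sum_range_succ _ _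

lemma two0 : (2 : ZMod 2) = 0 := rfl

/-- Walking right along a row. -/
lemma row_conn {n : ℕ} {γ : (gridGraph n).E → ZMod 2} {σ : ℕ × ℕ → ZMod 2}
    {S : Set (ℕ × ℕ)} {r L : ℕ} (d : ℕ) : ∀ x, x + d = L →
    (∀ y, x ≤ y → y < L → Step n γ σ S (r, y) (r, y + 1)) →
    Relation.ReflTransGen (Step n γ σ S) (r, x) (r, L) := by
  induction d with
  | zero => intro x hx _; rw [← hx]; exact .refl
  | succ d ih =>
    intro x hx h
    exact .head (h x le_rfl (by omega)) (ih (x + 1) (by omega)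
      fun y h1 h2 => h y (by omega) h2)

/-- Walking up along a column. -/
lemma col_conn {n : ℕ} {γ : (gridGraph n).E → ZMod 2} {σ : ℕ × ℕ → ZMod 2}
    {S : Set (ℕ × ℕ)} {c R : ℕ} (d : ℕ)
    (h : ∀ y, R ≤ y → y < R + d → Step n γ σ S (y, c) (y + 1, c)) :
    Relation.ReflTransGen (Step n γ σ S) (R + d, c) (R, c) := by
  induction d with
  | zero => exact .refl
  | succ d ih =>
    exact .head (h (R + d) (by omega) (by omega)).symm (ih fun y h1 h2 => h y h1 (by omega))

/-- The branch set inside one block with an odd face. -/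
lemma block (n : ℕ) (γ : (gridGraph n).E → ZMod 2) (D L R T r c : ℕ)
    (hT : T < n) (hL : L < n) (hRr : R ≤ r) (hrT : r + 1 ≤ T) (hc : D + 1 ≤ c) (hcL : c + 1 ≤ L)
    (odd : hLab n γ r c + vLab n γ r (c + 1) + hLab n γ (r + 1) c + vLab n γ r c = 1) :
    ∃ (S : Set (ℕ × ℕ)) (σ : ℕ × ℕ → ZMod 2),
      (∀ p ∈ S, R ≤ p.1 ∧ p.1 ≤ T ∧ D + 1 ≤ p.2 ∧ p.2 ≤ L) ∧
      (∀ x, R ≤ x → x ≤ T → (x, L) ∈ S) ∧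
      (∀ x, σ (x, L) = tau n γ L x) ∧
      (∃ x, R ≤ x ∧ x ≤ T ∧ (x, D + 1) ∈ S ∧
        hLab n γ x D + tau n γ D x + σ (x, D + 1) = 0) ∧
      ∀ q ∈ S, Relation.ReflTransGen (Step n γ σ S) q (R, L) := by
  let A : ℕ → ZMod 2 := fun y => tau n γ D r + ∑ x ∈ Finset.Ico D y, hLab n γ r x
  have A0 : A D = tau n γ D r := by simp [A]
  have As : ∀ y, D ≤ y → A (y + 1) = A y + hLab n γ r y := by
    intro y hy
    simp only [A]
    rw [Finset.sum_Ico_succ_top hy]; ring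
  by_cases hA : A L = tau n γ L r
  · let S : Set (ℕ × ℕ) := {p | (R ≤ p.1 ∧ p.1 ≤ T ∧ D + 1 ≤ p.2 ∧ p.2 ≤ L) ∧
      (p.2 = L ∨ p.1 = r)}
    have hS : ∀ x y, (x, y) ∈ S ↔ (R ≤ x ∧ x ≤ T ∧ D + 1 ≤ y ∧ y ≤ L) ∧
      (y = L ∨ x = r) := fun _ _ => Iff.rfl
    let σ : ℕ × ℕ → ZMod 2 := fun p => if p.2 = L then tau n γ L p.1 else A p.2
    have σL : ∀ x, σ (x, L) = tau n γ L x := fun x => by simp [σ]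
    have σr : ∀ y, σ (r, y) = A y := by
      intro y
      simp only [σ]
      split_ifs with h
      · rw [h, hA]
      · rfl
    have hcol : ∀ x, R ≤ x → x ≤ T →
        Relation.ReflTransGen (Step n γ σ S) (x, L) (R, L) := by
      intro x h1 h2
      obtain ⟨d, rfl⟩ := Nat.exists_eq_add_of_le h1
      refine col_conn d fun y h3 h4 => ⟨?_, ?_, Ev.down (by omega) hL ?_⟩
      · rw [hS]; omega
      · rw [hS]; omega
      · rw [σL, σL, tau_succ]
        linear_combination (vLab n γ y L + tau n γ L y) * two0
    refine ⟨S, σ, fun p hp => hp.1, ?_, σL, ⟨r, hRr, by omega, ?_, ?_⟩, ?_⟩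
    · intro x h1 h2; rw [hS]; omega
    · rw [hS]; omega
    · rw [σr, As D le_rfl, A0]
      linear_combination (hLab n γ r D + tau n γ D r) * two0
    · rintro ⟨x, y⟩ ⟨⟨h1, h2, h3, h4⟩, h5⟩
      simp only at h1 h2 h3 h4 h5
      rcases h5 with rfl | rfl
      · exact hcol x h1 h2
      · refine .trans (row_conn (L - y) y (by omega) fun z hz hz' => ⟨?_, ?_, Ev.right (by omega) (by omega) ?_⟩) (hcol x h1 h2)
        · rw [hS]; omega
        · rw [hS]; omega
        · rw [σr, σr, As z (by omega)]
          linear_combination (hLab n γ x z + A z) * two0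
  · have hA' : tau n γ L r = A L + 1 := by
      have : ∀ a b : ZMod 2, ¬ a = b → b = a + 1 := by decide
      exact this _ _ hA
    let S : Set (ℕ × ℕ) := {p | (R ≤ p.1 ∧ p.1 ≤ T ∧ D + 1 ≤ p.2 ∧ p.2 ≤ L) ∧
      (p.2 = L ∨ p.1 = r ∨ (p.1 = r + 1 ∧ (p.2 = c ∨ p.2 = c + 1)))}
    have hS : ∀ x y, (x, y) ∈ S ↔ (R ≤ x ∧ x ≤ T ∧ D + 1 ≤ y ∧ y ≤ L) ∧
      (y = L ∨ x = r ∨ (x = r + 1 ∧ (y = c ∨ y = c + 1))) := fun _ _ => Iff.rfl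
    let σ : ℕ × ℕ → ZMod 2 := fun p => if p.2 = L then tau n γ L p.1 else
      if p.1 = r then (A p.2 + if p.2 ≤ c then 0 else 1) else
      if p.2 ≤ c then A c + vLab n γ r c else A (c + 1) + 1 + vLab n γ r (c + 1)
    have σL : ∀ x, σ (x, L) = tau n γ L x := fun x => by simp [σ]
    have σ1 : ∀ y, y ≤ c → σ (r, y) = A y := by
      intro y hy
      simp only [σ]
      rw [if_neg (by omega), if_pos trivial, if_pos hy, add_zero]
    have σ2 : ∀ y, c < y → σ (r, y) = A y + 1 := by
      intro y hy
      simp only [σ]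
      split_ifs with h h'
      · rw [h, hA']
      · omega
      · rfl
    have σ3 : σ (r + 1, c) = A c + vLab n γ r c := by
      simp only [σ]
      rw [if_neg (by omega), if_neg (by omega), if_pos le_rfl]
    have σ4 : σ (r + 1, c + 1) = A (c + 1) + 1 + vLab n γ r (c + 1) := by
      simp only [σ]
      by_cases h : c + 1 = L
      · rw [if_pos h, tau_succ, hA', h]
      · rw [if_neg h, if_neg (by omega), if_neg (by omega)]
    have hcol : ∀ x, R ≤ x → x ≤ T →
        Relation.ReflTransGen (Step n γ σ S) (x, L) (R, L) := by
      intro x h1 h2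
      obtain ⟨d, rfl⟩ := Nat.exists_eq_add_of_le h1
      refine col_conn d fun y h3 h4 => ⟨?_, ?_, Ev.down (by omega) hL ?_⟩
      · rw [hS]; omega
      · rw [hS]; omega
      · rw [σL, σL, tau_succ]
        linear_combination (vLab n γ y L + tau n γ L y) * two0
    have hrow2 : ∀ y, c < y → y ≤ L →
        Relation.ReflTransGen (Step n γ σ S) (r, y) (R, L) := by
      intro y h1 h2
      refine .trans (row_conn (L - y) y (by omega) fun z hz hz' =>
        ⟨?_, ?_, Ev.right (by omega) (by omega) ?_⟩) (hcol r hRr (by omega))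
      · rw [hS]; omega
      · rw [hS]; omega
      · rw [σ2 _ (by omega), σ2 _ (by omega), As z (by omega)]
        linear_combination (hLab n γ r z + A z + 1) * two0
    have h4 : Relation.ReflTransGen (Step n γ σ S) (r + 1, c + 1) (R, L) := by
      refine .head (Step.symm ⟨?_, ?_, Ev.down (by omega) (by omega) ?_⟩)
        (hrow2 (c + 1) (by omega) hcL)
      · rw [hS]; omega
      · rw [hS]; omega
      · rw [σ2 _ (by omega), σ4]
        linear_combination (vLab n γ r (c + 1) + A (c + 1) + 1) * two0
    have h3 : Relation.ReflTransGen (Step n γ σ S) (r + 1, c) (R, L) := by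
      refine .head ⟨?_, ?_, Ev.right (by omega) (by omega) ?_⟩ h4
      · rw [hS]; omega
      · rw [hS]; omega
      · rw [σ3, σ4, As c (by omega)]
        linear_combination odd + (A c + 1) * two0
    have hc1 : Relation.ReflTransGen (Step n γ σ S) (r, c) (R, L) := by
      refine .head ⟨?_, ?_, Ev.down (by omega) (by omega) ?_⟩ h3
      · rw [hS]; omega
      · rw [hS]; omega
      · rw [σ3, σ1 _ le_rfl]
        linear_combination (A c + vLab n γ r c) * two0
    have hrow1 : ∀ y, D + 1 ≤ y → y ≤ c →
        Relation.ReflTransGen (Step n γ σ S) (r, y) (R, L) := by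
      intro y h1 h2
      refine .trans (row_conn (c - y) y (by omega) fun z hz hz' =>
        ⟨?_, ?_, Ev.right (by omega) (by omega) ?_⟩) hc1
      · rw [hS]; omega
      · rw [hS]; omega
      · rw [σ1 _ (by omega), σ1 _ (by omega), As z (by omega)]
        linear_combination (hLab n γ r z + A z) * two0
    refine ⟨S, σ, fun p hp => hp.1, ?_, σL, ⟨r, hRr, by omega, ?_, ?_⟩, ?_⟩
    · intro x h1 h2; rw [hS]; omega
    · rw [hS]; omega
    · rw [σ1 _ (by omega), As D le_rfl, A0]
      linear_combination (hLab n γ r D + tau n γ D r) * two0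
    · rintro ⟨x, y⟩ ⟨⟨h1, h2, h3', h4'⟩, h5⟩
      simp only at h1 h2 h3' h4' h5
      rcases h5 with rfl | rfl | ⟨rfl, rfl | rfl⟩
      · exact hcol x h1 h2
      · rcases Nat.lt_or_ge c y with h | h
        · exact hrow2 y h h4'
        · exact hrow1 y h3' h
      · exact h3
      · exact h4

/-- Case of a block all of whose faces are even. -/
lemma flat_case (k n : ℕ) (γ : (gridGraph n).E → ZMod 2) (R C : ℕ)
    (hR : R + k ≤ n) (hC : C + k ≤ n)
    (even : ∀ r c, R ≤ r → r + 1 < R + k → C ≤ c → c + 1 < C + k →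
      hLab n γ r c + vLab n γ r (c + 1) + hLab n γ (r + 1) c + vLab n γ r c = 0) :
    IsRootedSignedMinor (gridGraph k) (γ₀ (gridGraph k)) (firstRow k)
      (gridGraph n) γ (firstRow n) := by
  let σ : ℕ × ℕ → ZMod 2 := fun p =>
    (∑ x ∈ Finset.range p.2, hLab n γ R x) + tau n γ p.2 p.1 + tau n γ p.2 R
  have hver : ∀ r c, vLab n γ r c + σ (r, c) + σ (r + 1, c) = 0 := by
    intro r c
    simp only [σ, tau_succ]
    linear_combination (vLab n γ r c + (∑ x ∈ Finset.range c, hLab n γ R x) + tau n γ c r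
      + tau n γ c R) * two0
  have hhor : ∀ d c, R + d < R + k → C ≤ c → c + 1 < C + k →
      hLab n γ (R + d) c + σ (R + d, c) + σ (R + d, c + 1) = 0 := by
    intro d c hd h1 h2
    induction d with
    | zero =>
      simp only [σ, Finset.sum_range_succ, add_zero]
      linear_combination (hLab n γ R c + (∑ x ∈ Finset.range c, hLab n γ R x) + tau n γ c R
        + tau n γ (c + 1) R) * two0
    | succ d ih =>
      have h3 := ih (by omega)
      have h4 := even (R + d) c (by omega) (by omega) h1 h2
      have h5 := hver (R + d) c
      have h6 := hver (R + d) (c + 1)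
      rw [← add_assoc]
      linear_combination h3 + h4 + h5 + h6 - (σ (R + d, c) + σ (R + d, c + 1) + hLab n γ (R + d) c
        + vLab n γ (R + d) c + vLab n γ (R + d) (c + 1)) * two0
  refine core k n γ σ (fun a b => {p | p.2 = C + b ∧ (p.1 = R + a ∨ (a = 0 ∧ p.1 ≤ R))})
    ?_ ?_ ?_ ?_ ?_ ?_
  · rintro a b ha hb ⟨x, y⟩ hp
    simp only [Set.mem_ofPred_eq] at hp ⊢
    omega
  · rintro a b a' b' _ _ _ _ ⟨x, y⟩ hp hq
    simp only [Set.mem_ofPred_eq] at hp hq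
    omega
  · intro a b ha hb
    by_cases h0 : a = 0
    · subst h0
      refine ⟨(0, C + b), by simp, ?_⟩
      rintro ⟨x, y⟩ hp
      simp only [Set.mem_ofPred_eq] at hp
      obtain ⟨rfl, hx⟩ := hp
      have := col_conn (n := n) (γ := γ) (σ := σ) (c := C + b) (R := 0)
        (S := {p | p.2 = C + b ∧ (p.1 = R + 0 ∨ (0 = 0 ∧ p.1 ≤ R))}) x
        (fun z _ h2 => ⟨⟨rfl, Or.inr ⟨rfl, by simp only; omega⟩⟩,
          ⟨rfl, Or.inr ⟨rfl, by simp only; omega⟩⟩,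
          Ev.down (by omega) (by omega) (hver _ _)⟩)
      rw [zero_add] at this
      exact this
    · refine ⟨(R + a, C + b), by simp, ?_⟩
      rintro ⟨x, y⟩ hp
      simp only [Set.mem_ofPred_eq] at hp
      obtain ⟨rfl, hx⟩ := hp
      have : x = R + a := by omega
      rw [this]
  · intro b hb
    exact ⟨C + b, by simp⟩
  · intro a b ha hb
    exact ⟨(R + a, C + b), by simp, (R + a, C + b + 1), by simp; omega,
      Ev.right (by omega) (by omega) (hhor _ _ (by omega) (by omega) (by omega))⟩
  · intro a b ha hb
    exact ⟨(R + a, C + b), by simp, (R + a + 1, C + b), by simp; omega,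
      Ev.down (by omega) (by omega) (hver _ _)⟩

/-- Case where every block has an odd face. -/
lemma odd_case (k n : ℕ) (hn : n = k * k) (γ : (gridGraph n).E → ZMod 2)
    (odd : ∀ i j, i < k → j < k → ∃ r c, i * k ≤ r ∧ r + 1 < i * k + k ∧ j * k ≤ c ∧
      c + 1 < j * k + k ∧
      hLab n γ r c + vLab n γ r (c + 1) + hLab n γ (r + 1) c + vLab n γ r c = 1) :
    IsRootedSignedMinor (gridGraph k) (γ₀ (gridGraph k)) (firstRow k)
      (gridGraph n) γ (firstRow n) := by
  have bd : ∀ i, i < k → i * k + k ≤ n := by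
    intro i hi
    rw [hn, ← Nat.succ_mul]
    exact Nat.mul_le_mul_right k hi
  have key : ∀ i j, ∃ (S : Set (ℕ × ℕ)) (σ : ℕ × ℕ → ZMod 2), i < k → j < k →
      (∀ p ∈ S, i * k ≤ p.1 ∧ p.1 < i * k + k ∧ j * k ≤ p.2 ∧ p.2 < j * k + k) ∧
      (∀ x, i * k ≤ x → x < i * k + k → (x, j * k + (k - 1)) ∈ S) ∧
      (∀ x, σ (x, j * k + (k - 1)) = tau n γ (j * k + (k - 1)) x) ∧
      (0 < j → ∃ x, i * k ≤ x ∧ x < i * k + k ∧ (x, j * k) ∈ S ∧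
        hLab n γ x (j * k - 1) + tau n γ (j * k - 1) x + σ (x, j * k) = 0) ∧
      ∀ q ∈ S, Relation.ReflTransGen (Step n γ σ S) q (i * k, j * k + (k - 1)) := by
    intro i j
    by_cases hij : i < k ∧ j < k
    swap
    · exact ⟨∅, 0, fun h1 h2 => absurd ⟨h1, h2⟩ hij⟩
    obtain ⟨hi, hj⟩ := hij
    have bi := bd i hi
    have bj := bd j hj
    rcases Nat.eq_zero_or_pos j with rfl | hj0
    · refine ⟨{p | (i * k ≤ p.1 ∧ p.1 < i * k + k) ∧ p.2 = 0 * k + (k - 1)},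
        fun p => tau n γ p.2 p.1, fun _ _ => ⟨?_, ?_, fun _ => rfl, fun h => absurd h (by omega), ?_⟩⟩
      · rintro ⟨x, y⟩ hp
        simp only [Set.mem_ofPred_eq] at hp ⊢
        omega
      · intro x h1 h2
        exact ⟨⟨h1, h2⟩, rfl⟩
      · rintro ⟨x, y⟩ ⟨⟨h1, h2⟩, h3⟩
        simp only at h1 h2 h3
        subst h3
        obtain ⟨d, rfl⟩ := Nat.exists_eq_add_of_le h1
        refine col_conn d fun y h3 h4 => ⟨?_, ?_, Ev.down (by omega) (by omega) ?_⟩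
        · exact ⟨⟨h3, by simp only; omega⟩, rfl⟩
        · exact ⟨⟨by simp only; omega, by simp only; omega⟩, rfl⟩
        · simp only [tau_succ]
          linear_combination (vLab n γ y (0 * k + (k - 1)) + tau n γ (0 * k + (k - 1)) y) * two0
    · obtain ⟨r, c, h1, h2, h3, h4, h5⟩ := odd i j hi hj
      have hjk : 0 < j * k := Nat.mul_pos hj0 (by omega)
      obtain ⟨S, σ, s1, s2, s3, ⟨x, hx1, hx2, hx3, hx4⟩, s5⟩ :=
        block n γ (j * k - 1) (j * k + (k - 1)) (i * k) (i * k + (k - 1)) r c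
        (by omega) (by omega) h1 (by omega) (by omega) (by omega) h5
      have e1 : j * k - 1 + 1 = j * k := by omega
      rw [e1] at hx3 hx4
      refine ⟨S, σ, fun _ _ => ⟨?_, fun x h1 h2 => s2 x h1 (by omega), s3,
        fun _ => ⟨x, hx1, by omega, hx3, hx4⟩, s5⟩⟩
      intro p hp
      have := s1 p hp
      omega
  choose S σ key using key
  let sig : ℕ × ℕ → ZMod 2 := fun p => σ (p.1 / k) (p.2 / k) p
  have dv : ∀ i x, i * k ≤ x → x < i * k + k → x / k = i := by
    intro i x h1 h2
    exact Nat.div_eq_of_lt_le h1 (by rw [Nat.succ_mul]; exact h2)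
  have hsig : ∀ i j, i < k → j < k → ∀ p ∈ S i j, sig p = σ i j p := by
    intro i j hi hj p hp
    obtain ⟨h1, h2, h3, h4⟩ := (key i j hi hj).1 p hp
    simp only [sig]
    rw [dv i _ h1 h2, dv j _ h3 h4]
  refine core k n γ sig S ?_ ?_ ?_ ?_ ?_ ?_
  · intro a b ha hb p hp
    have := (key a b ha hb).1 p hp
    have := bd a ha
    have := bd b hb
    omega
  · intro a b a' b' ha hb ha' hb' p hp hq
    obtain ⟨h1, h2, h3, h4⟩ := (key a b ha hb).1 p hp
    obtain ⟨g1, g2, g3, g4⟩ := (key a' b' ha' hb').1 p hq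
    exact ⟨(dv a _ h1 h2).symm.trans (dv a' _ g1 g2), (dv b _ h3 h4).symm.trans (dv b' _ g3 g4)⟩
  · intro a b ha hb
    obtain ⟨-, s2, -, -, s5⟩ := key a b ha hb
    refine ⟨_, s2 (a * k) le_rfl (by omega), fun q hq => Relation.ReflTransGen.mono ?_ _ _ (s5 q hq)⟩
    rintro x y ⟨hx, hy, hxy⟩
    exact ⟨hx, hy, hxy.congr (hsig a b ha hb x hx) (hsig a b ha hb y hy)⟩
  · intro b hb
    exact ⟨_, (key 0 b (by omega) hb).2.1 0 (by omega) (by omega)⟩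
  · intro a b ha hb
    obtain ⟨-, s2, s3, -, -⟩ := key a b ha (by omega)
    obtain ⟨-, -, -, s4, -⟩ := key a (b + 1) ha hb
    obtain ⟨x, h1, h2, h3, h4⟩ := s4 (by omega)
    have e1 : (b + 1) * k = b * k + (k - 1) + 1 := by rw [Nat.succ_mul]; omega
    have e2 : (b + 1) * k - 1 = b * k + (k - 1) := by omega
    have m1 := s2 x h1 h2
    refine ⟨_, m1, _, h3, ?_⟩
    have := bd a ha
    have := bd (b + 1) hb
    have z1 := hsig _ _ ha (by omega) _ m1
    have z2 := hsig _ _ ha hb _ h3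
    rw [s3] at z1
    rw [e2, ← z1, ← z2] at h4
    rw [e1] at h4 ⊢
    exact Ev.right (by omega) (by omega) h4
  · intro a b ha hb
    obtain ⟨-, s2, s3, -, -⟩ := key a b (by omega) hb
    obtain ⟨-, t2, t3, -, -⟩ := key (a + 1) b ha hb
    have e1 : (a + 1) * k = a * k + (k - 1) + 1 := by rw [Nat.succ_mul]; omega
    have m1 := s2 (a * k + (k - 1)) (by omega) (by omega)
    have m2 := t2 (a * k + (k - 1) + 1) (by omega) (by omega)
    refine ⟨_, m1, _, m2, ?_⟩
    have := bd (a + 1) ha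
    have := bd b hb
    refine Ev.down (by omega) (by omega) ?_
    rw [hsig _ _ (by omega) hb _ m1, hsig _ _ ha hb _ m2, s3, t3, tau_succ]
    linear_combination (vLab n γ (a * k + (k - 1)) (b * k + (k - 1))
      + tau n γ (b * k + (k - 1)) (a * k + (k - 1))) * two0

/-- Any signing of the `k² × k²` grid rooted at its first row
contains the rooted grid `𝒲_k` as a rooted signed graph minor. -/
theorem statement_7 (k : ℕ) (γ : (gridGraph (k ^ 2)).E → ZMod 2) :
    IsRootedSignedMinor (gridGraph k) (γ₀ (gridGraph k)) (firstRow k)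
      (gridGraph (k ^ 2)) γ (firstRow (k ^ 2)) := by
  by_cases h : ∃ i j, i < k ∧ j < k ∧ ∀ r c, i * k ≤ r → r + 1 < i * k + k → j * k ≤ c →
      c + 1 < j * k + k → hLab (k ^ 2) γ r c + vLab (k ^ 2) γ r (c + 1)
        + hLab (k ^ 2) γ (r + 1) c + vLab (k ^ 2) γ r c = 0
  · obtain ⟨i, j, hi, hj, hij⟩ := h
    have bd : ∀ i, i < k → i * k + k ≤ k ^ 2 := by
      intro i hi
      rw [sq, ← Nat.succ_mul]
      exact Nat.mul_le_mul_right k hi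
    exact flat_case k _ γ (i * k) (j * k) (bd i hi) (bd j hj) hij
  · refine odd_case k _ (sq k) γ fun i j hi hj => ?_
    by_contra hcon
    refine h ⟨i, j, hi, hj, fun r c h1 h2 h3 h4 => ?_⟩
    by_contra hne
    have : ∀ a : ZMod 2, ¬ a = 0 → a = 1 := by decide
    exact hcon ⟨r, c, h1, h2, h3, h4, this _ hne⟩

end TDMPaper
end

section
/- Let A ∈ ℤ^{m×n} have exactly two nonzero entries per row and let (G,γ,K) = G⁺_•(A). If A is totally Δ-modular, then: (1) ‖A‖_∞ ≤ Δ; (2) |K| ≤ 2·log₂Δ; and (3) OCP(G,γ) ≤ log₂Δ. Conversely, if Δ is the largest absolute value of a subdeterminant of A, then Δ ≤ 2^{OCP(G,γ)} · ‖A‖_∞^{|K|}. -/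
namespace TDMPaper

open MGraph

section Aux

open Matrix

lemma row_nz {m n : ℕ} {A : Matrix (Fin m) (Fin n) ℤ} (h : TwoNonzeroPerRow A)
    {i : Fin m} {u v x : Fin n} (huv : u ≠ v) (hu : A i u ≠ 0) (hv : A i v ≠ 0)
    (hx : A i x ≠ 0) : x = u ∨ x = v := by
  obtain ⟨p, q, hpq, hs⟩ := Set.ncard_eq_two.mp (h i)
  have hu' : u ∈ ({p, q} : Set (Fin n)) := hs ▸ hu
  have hv' : v ∈ ({p, q} : Set (Fin n)) := hs ▸ hv
  have hx' : x ∈ ({p, q} : Set (Fin n)) := hs ▸ hx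
  simp only [Set.mem_insert_iff, Set.mem_singleton_iff] at hu' hv' hx'
  grind

lemma ends_iff {m n : ℕ} {A : Matrix (Fin m) (Fin n) ℤ} (h : TwoNonzeroPerRow A)
    (i : Fin m) (u v : Fin n) :
    (matrixGraph A h).ends i = s(u, v) ↔ u ≠ v ∧ A i u ≠ 0 ∧ A i v ≠ 0 := by
  have hs := (Set.ncard_eq_two.mp (h i)).choose_spec.choose_spec
  have he : (matrixGraph A h).ends i = s((Set.ncard_eq_two.mp (h i)).choose,
    (Set.ncard_eq_two.mp (h i)).choose_spec.choose) := rfl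
  rw [he]
  generalize (Set.ncard_eq_two.mp (h i)).choose_spec.choose = q at *
  generalize (Set.ncard_eq_two.mp (h i)).choose = p at *
  obtain ⟨hpq, hs⟩ := hs
  have key : ∀ x, A i x ≠ 0 ↔ x = p ∨ x = q := fun x => by
    have : x ∈ {j | A i j ≠ 0} ↔ x ∈ ({p, q} : Set (Fin n)) := by rw [hs]
    simpa using this
  rw [key, key]
  erw [Sym2.eq_iff]
  grind

lemma sign_eq {m n : ℕ} {A : Matrix (Fin m) (Fin n) ℤ} (h : TwoNonzeroPerRow A)
    {i : Fin m} {u v : Fin n} (huv : u ≠ v) (hu : A i u ≠ 0) (hv : A i v ≠ 0) :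
    matrixSign A i = if A i u * A i v < 0 then 0 else 1 := by
  have : Finset.univ.filter (fun j => A i j ≠ 0) = {u, v} := by
    ext x
    simp only [Finset.mem_filter, Finset.mem_univ, true_and, Finset.mem_insert,
      Finset.mem_singleton]
    constructor
    · exact row_nz h huv hu hv
    · rintro (rfl | rfl) <;> assumption
  unfold matrixSign
  rw [this, Finset.prod_pair huv]

lemma parity_sign {ι : Type} (s : Finset ι) (c : ι → ℤ) (hc : ∀ i, c i ≠ 0) :
    ((∑ i ∈ s, (if c i < 0 then (0 : ZMod 2) else 1)) = 0 ∧ 0 < ∏ i ∈ s, (- c i)) ∨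
    ((∑ i ∈ s, (if c i < 0 then (0 : ZMod 2) else 1)) = 1 ∧ ∏ i ∈ s, (- c i) < 0) := by
  classical
  induction s using Finset.induction_on with
  | empty => left; simp
  | insert a s ha ih =>
    rw [Finset.sum_insert ha, Finset.prod_insert ha]
    rcases lt_or_gt_of_ne (hc a) with h | h
    · rw [if_pos h]
      rcases ih with ⟨h1, h2⟩ | ⟨h1, h2⟩
      · left; exact ⟨by rw [h1]; rfl, by nlinarith⟩
      · right; exact ⟨by rw [h1]; rfl, by nlinarith⟩
    · rw [if_neg (by omega)]
      rcases ih with ⟨h1, h2⟩ | ⟨h1, h2⟩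
      · right; exact ⟨by rw [h1]; rfl, by nlinarith⟩
      · left; exact ⟨by rw [h1]; rfl, by nlinarith⟩

lemma fin_one_ne {k : ℕ} (hk : 1 ≤ k) : (1 : Fin (k + 1)) ≠ 0 := by
  obtain ⟨k, rfl⟩ : ∃ k', k = k' + 1 := ⟨k - 1, by omega⟩
  simp

lemma fin_succ_val {k : ℕ} (i : Fin (k + 1)) : (i + 1).val = (i.1 + 1) % (k + 1) := by
  simp [Fin.val_add]

open Fin.NatCast Fin.CommRing in
lemma cyc_perm {k : ℕ} (σ : Equiv.Perm (Fin (k + 1)))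
    (hσ : ∀ i, σ i = i ∨ σ i = i + 1) : σ = 1 ∨ σ = finRotate (k + 1) := by
  by_cases hfix : ∃ i, σ i = i
  · left
    obtain ⟨i, hi⟩ := hfix
    have step : ∀ j, σ (j + 1) = j + 1 → σ j = j := by
      intro j hj
      rcases hσ j with h | h
      · exact h
      · have := σ.injective (h.trans hj.symm)
        rw [← this] at hj
        exact hj
    have all : ∀ t : ℕ, σ (i - (t : Fin (k + 1))) = i - (t : Fin (k + 1)) := by
      intro t
      induction t with
      | zero => simpa using hi
      | succ t ih =>
        apply step
        have : i - ((t + 1 : ℕ) : Fin (k + 1)) + 1 = i - (t : Fin (k + 1)) := by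
          push_cast; ring
        rw [this]; exact ih
    ext1 j
    have := all (i - j).val
    simpa using this
  · right
    push Not at hfix
    ext1 j
    rw [finRotate_apply]
    exact (hσ j).resolve_left (hfix j)

lemma det_cyc {k : ℕ} (hk : 1 ≤ k) (M : Matrix (Fin (k + 1)) (Fin (k + 1)) ℤ)
    (hM : ∀ i j, M i j ≠ 0 → j = i ∨ j = i + 1) :
    M.det = ∏ i, M i i + (-1) ^ k * ∏ i, M i (i + 1) := by
  have hne : (1 : Equiv.Perm (Fin (k + 1))) ≠ finRotate (k + 1) := by
    intro hc
    have h0 := congrArg (fun σ : Equiv.Perm (Fin (k + 1)) => σ 0) hc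
    simp only [finRotate_apply, zero_add, Equiv.Perm.coe_one, id_eq] at h0
    exact fin_one_ne hk h0.symm
  rw [← Matrix.det_transpose, Matrix.det_apply']
  rw [← Finset.sum_subset (Finset.subset_univ {1, finRotate (k + 1)})]
  · rw [Finset.sum_pair hne]
    simp [sign_finRotate]
  · intro σ _ hσ
    apply mul_eq_zero_of_right
    by_contra hc
    have hc := Finset.prod_ne_zero_iff.mp hc
    apply hσ
    simp only [Finset.mem_insert, Finset.mem_singleton]
    exact cyc_perm σ fun i => hM i (σ i) (hc i (Finset.mem_univ _))

/-- The determinant of the matrix of a cycle. -/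
lemma cyc_core {m n : ℕ} {A : Matrix (Fin m) (Fin n) ℤ} (h : TwoNonzeroPerRow A)
    {k : ℕ} (hk : 1 ≤ k) (vtx : Fin (k + 1) → Fin n) (edge : Fin (k + 1) → Fin m)
    (hv : Function.Injective vtx)
    (h1 : ∀ i, A (edge i) (vtx i) ≠ 0) (h2 : ∀ i, A (edge i) (vtx (i + 1)) ≠ 0) :
    (∑ i, matrixSign A (edge i) = 1 →
      (A.submatrix edge vtx).det.natAbs =
        (∏ i, (A (edge i) (vtx i)).natAbs) + ∏ i, (A (edge i) (vtx (i + 1))).natAbs) ∧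
    (∑ i, matrixSign A (edge i) ≠ 1 →
      (A.submatrix edge vtx).det.natAbs ≤
        max (∏ i, (A (edge i) (vtx i)).natAbs) (∏ i, (A (edge i) (vtx (i + 1))).natAbs)) := by
  have hii : ∀ i : Fin (k + 1), i ≠ i + 1 := by
    intro i hi
    exact fin_one_ne hk (by simpa using hi)
  have hvv : ∀ i, vtx i ≠ vtx (i + 1) := fun i hc => hii i (hv hc)
  have hdet := det_cyc hk (A.submatrix edge vtx) (by
    intro i j hij
    rcases row_nz h (hvv i) (h1 i) (h2 i) hij with h | h
    · exact Or.inl (hv h)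
    · exact Or.inr (hv h))
  simp only [Matrix.submatrix_apply] at hdet
  have hs : ∑ i, matrixSign A (edge i) = ∑ i, (if A (edge i) (vtx i) * A (edge i) (vtx (i + 1)) < 0
      then (0 : ZMod 2) else 1) :=
    Finset.sum_congr rfl fun i _ => sign_eq h (hvv i) (h1 i) (h2 i)
  have hp := parity_sign Finset.univ (fun i => A (edge i) (vtx i) * A (edge i) (vtx (i + 1)))
    (fun i => mul_ne_zero (h1 i) (h2 i))
  have hprod : ∏ i, (-(A (edge i) (vtx i) * A (edge i) (vtx (i + 1)))) =
      - ((∏ i, A (edge i) (vtx i)) * ((-1) ^ k * ∏ i, A (edge i) (vtx (i + 1)))) := by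
    rw [Finset.prod_neg, Finset.prod_mul_distrib, Finset.card_univ, Fintype.card_fin]
    ring
  rw [hprod, ← hs] at hp
  rw [hdet]
  have e1 : ∏ i, (A (edge i) (vtx i)).natAbs = (∏ i, A (edge i) (vtx i)).natAbs :=
    (map_prod Int.natAbsHom _ _).symm
  have e2 : ∏ i, (A (edge i) (vtx (i + 1))).natAbs =
      ((-1) ^ k * ∏ i, A (edge i) (vtx (i + 1))).natAbs := by
    rw [Int.natAbs_mul, Int.natAbs_pow]
    rw [Int.natAbs_neg, Int.natAbs_one, one_pow, one_mul]
    exact (map_prod Int.natAbsHom _ _).symm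
  rw [e1, e2]
  generalize (∏ i, A (edge i) (vtx i)) = x at *
  generalize ((-1) ^ k * ∏ i, A (edge i) (vtx (i + 1))) = y at *
  constructor
  · intro hodd
    have hxy : 0 < x * y := by
      rcases hp with ⟨h0, _⟩ | ⟨_, h0⟩
      · rw [hodd] at h0; exact absurd h0 (by decide)
      · linarith
    rcases mul_pos_iff.mp hxy with h | h <;> omega
  · intro hev
    have hxy : x * y < 0 := by
      rcases hp with ⟨_, h0⟩ | ⟨h0, _⟩
      · linarith
      · exact absurd h0 hev
    rcases mul_neg_iff.mp hxy with h | h <;> omega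

lemma tdm_fintype {m n : ℕ} {A : Matrix (Fin m) (Fin n) ℤ} {Δ : ℕ}
    (ht : TotallyDeltaModular A Δ) {ι : Type} [Fintype ι] [DecidableEq ι]
    (r : ι → Fin m) (c : ι → Fin n) (hr : Function.Injective r) (hc : Function.Injective c) :
    (A.submatrix r c).det.natAbs ≤ Δ := by
  have e := (Fintype.equivFin ι).symm
  have := ht _ (r ∘ e) (c ∘ e) (hr.comp e.injective) (hc.comp e.injective)
  rwa [← Matrix.submatrix_submatrix, Matrix.det_submatrix_equiv_self] at this

lemma le_maxAbs {m n : ℕ} (A : Matrix (Fin m) (Fin n) ℤ) (i j) :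
    (A i j).natAbs ≤ maxAbsEntry A := by
  unfold maxAbsEntry
  exact (Finset.le_sup (f := fun j => (A i j).natAbs) (Finset.mem_univ j)).trans
    (Finset.le_sup (f := fun i => Finset.sup Finset.univ fun j => (A i j).natAbs)
      (Finset.mem_univ i))

lemma part1 {m n : ℕ} {A : Matrix (Fin m) (Fin n) ℤ} {Δ : ℕ}
    (ht : TotallyDeltaModular A Δ) : maxAbsEntry A ≤ Δ := by
  unfold maxAbsEntry
  refine Finset.sup_le fun i _ => Finset.sup_le fun j _ => ?_
  have := tdm_fintype ht (ι := Unit) (fun _ => i) (fun _ => j)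
    (Function.injective_of_subsingleton _) (Function.injective_of_subsingleton _)
  simpa using this

lemma two_pow_le_logb {k Δ : ℕ} (hk : 2 ^ k ≤ Δ) : (k : ℝ) ≤ Real.logb 2 (Δ : ℝ) := by
  have hpos : (0 : ℝ) < Δ := by
    have : 0 < Δ := lt_of_lt_of_le (by positivity) hk
    exact_mod_cast this
  rw [Real.le_logb_iff_rpow_le (by norm_num) hpos, Real.rpow_natCast]
  exact_mod_cast hk

lemma part2 {m n : ℕ} {A : Matrix (Fin m) (Fin n) ℤ} (h : TwoNonzeroPerRow A) {Δ : ℕ}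
    (ht : TotallyDeltaModular A Δ) :
    ((matrixRoots A).ncard : ℝ) ≤ 2 * Real.logb 2 (Δ : ℝ) := by
  classical
  have hex' : ∀ v : matrixRoots A, ∃ i, 1 < (A i v.1).natAbs := fun v => v.2
  choose e he using hex'
  have hnz : ∀ v, A (e v) v.1 ≠ 0 := fun v hc => by
    have := he v
    rw [hc] at this
    simp at this
  have bound : ∀ S : Finset (matrixRoots A),
      ((∀ v ∈ S, ∀ u ∈ S, u < v → A (e v) u.1 = 0) ∨
        (∀ v ∈ S, ∀ u ∈ S, v < u → A (e v) u.1 = 0)) → 2 ^ S.card ≤ Δ := by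
    intro S hS
    have hdiag : (A.submatrix (fun v : S => e v.1) (fun v : S => v.1.1)).det =
        ∏ v : S, A (e v.1) v.1.1 := by
      rcases hS with hS | hS
      · exact Matrix.det_of_isUpperTriangular fun v u huv => hS v.1 v.2 u.1 u.2 huv
      · exact Matrix.det_of_isLowerTriangular _ fun v u huv => hS v.1 v.2 u.1 u.2 huv
    have hinj : Function.Injective (fun v : S => e v.1) := by
      intro v w hvw
      by_contra hne
      simp only at hvw
      rcases lt_or_gt_of_ne hne with hlt | hlt
      · rcases hS with hS | hS
        · exact hnz v.1 (hvw ▸ hS w.1 w.2 v.1 v.2 hlt)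
        · exact hnz w.1 (hvw ▸ hS v.1 v.2 w.1 w.2 hlt)
      · rcases hS with hS | hS
        · exact hnz w.1 (hvw ▸ hS v.1 v.2 w.1 w.2 hlt)
        · exact hnz v.1 (hvw ▸ hS w.1 w.2 v.1 v.2 hlt)
    have hb := tdm_fintype ht _ (fun v : S => v.1.1) hinj
      (Subtype.val_injective.comp Subtype.val_injective : Function.Injective (fun v : S => v.1.1))
    rw [hdiag] at hb
    refine le_trans ?_ hb
    have : (∏ v : S, A (e v.1) v.1.1).natAbs = ∏ v : S, (A (e v.1) v.1.1).natAbs :=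
      map_prod Int.natAbsHom _ _
    rw [this]
    calc 2 ^ S.card = ∏ v : S, 2 := by simp
      _ ≤ _ := Finset.prod_le_prod' fun v _ => he v.1
  let S1 : Finset (matrixRoots A) := Finset.univ.filter fun v => ∀ u, u < v → A (e v) u.1 = 0
  let S2 : Finset (matrixRoots A) := Finset.univ.filter fun v => ∀ u, v < u → A (e v) u.1 = 0
  have hcov : S1 ∪ S2 = Finset.univ := by
    rw [Finset.eq_univ_iff_forall]
    intro v
    simp only [S1, S2, Finset.mem_union, Finset.mem_filter, Finset.mem_univ, true_and]
    by_contra hc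
    push Not at hc
    obtain ⟨⟨u, hu, hu'⟩, ⟨w, hw, hw'⟩⟩ := hc
    have hu2 : u.1 < v.1 := hu
    have hw2 : v.1 < w.1 := hw
    rcases row_nz h (ne_of_lt hu2) hu' (hnz v) hw' with h | h
    · rw [h] at hw2; exact absurd hw2 (not_lt.mpr hu2.le)
    · rw [h] at hw2; exact lt_irrefl _ hw2
  have hcard : (matrixRoots A).ncard ≤ S1.card + S2.card := by
    rw [← Nat.card_coe_set_eq, Nat.card_eq_fintype_card, ← Finset.card_univ, ← hcov]
    exact Finset.card_union_le _ _
  have b1 := two_pow_le_logb (bound S1 (Or.inl fun v hv u _ huv =>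
    (Finset.mem_filter.mp hv).2 u huv))
  have b2 := two_pow_le_logb (bound S2 (Or.inr fun v hv u _ huv =>
    (Finset.mem_filter.mp hv).2 u huv))
  have : ((matrixRoots A).ncard : ℝ) ≤ S1.card + S2.card := by exact_mod_cast hcard
  linarith

/-- Unpack a cycle of the matrix graph. -/
lemma cycle_det {m n : ℕ} {A : Matrix (Fin m) (Fin n) ℤ} (h : TwoNonzeroPerRow A)
    (C : (matrixGraph A h).Cycle) (hC : C.parity (fun e => matrixSign A e) = 1) :
    2 ≤ ((A.submatrix C.edge C.vtx).det).natAbs := by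
  obtain ⟨k, npos, vtx, edge, hv, he, hends⟩ := C
  obtain ⟨k, rfl⟩ : ∃ k', k = k' + 1 := ⟨k - 1, by omega⟩
  have hk : 1 ≤ k := by
    by_contra hc
    obtain rfl : k = 0 := by omega
    have := (ends_iff h _ _ _).mp (hends 0)
    exact this.1 (congrArg vtx (Fin.ext (by simp)))
  have hsucc : ∀ i : Fin (k + 1), (⟨(i.1 + 1) % (k + 1), Nat.mod_lt _ npos⟩ : Fin (k + 1)) =
      i + 1 := by
    intro i
    apply Fin.ext
    exact (fin_succ_val i).symm
  have hends' : ∀ i, A (edge i) (vtx i) ≠ 0 ∧ A (edge i) (vtx (i + 1)) ≠ 0 := by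
    intro i
    have := (ends_iff h _ _ _).mp (hends i)
    rw [hsucc] at this
    exact this.2
  have := (cyc_core h hk vtx edge hv (fun i => (hends' i).1) (fun i => (hends' i).2)).1 hC
  simp only
  erw [this]
  have p1 : 0 < ∏ i, (A (edge i) (vtx i)).natAbs :=
    Finset.prod_pos fun i _ => Int.natAbs_pos.mpr (hends' i).1
  have p2 : 0 < ∏ i, (A (edge i) (vtx (i + 1))).natAbs :=
    Finset.prod_pos fun i _ => Int.natAbs_pos.mpr (hends' i).2
  omega

lemma cycle_nz {m n : ℕ} {A : Matrix (Fin m) (Fin n) ℤ} (h : TwoNonzeroPerRow A)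
    (C : (matrixGraph A h).Cycle) (i : Fin C.n) (v : Fin n) (hv : A (C.edge i) v ≠ 0) :
    v ∈ C.support := by
  have h3 := (ends_iff h _ _ _).mp (C.ends_eq i)
  rcases row_nz h h3.1 h3.2.1 h3.2.2 hv with rfl | rfl
  · exact ⟨_, rfl⟩
  · exact ⟨_, rfl⟩

lemma packing_le {m n : ℕ} {A : Matrix (Fin m) (Fin n) ℤ} (h : TwoNonzeroPerRow A) {Δ : ℕ}
    (ht : TotallyDeltaModular A Δ) {k : ℕ} (C : Fin k → (matrixGraph A h).Cycle)
    (hodd : ∀ i, (C i).parity (fun e => matrixSign A e) = 1)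
    (hdisj : ∀ i j, i ≠ j → Disjoint ((C i).support) ((C j).support)) : 2 ^ k ≤ Δ := by
  classical
  let r : (Σ t : Fin k, Fin (C t).n) → Fin m := fun p => (C p.1).edge p.2
  let c : (Σ t : Fin k, Fin (C t).n) → Fin n := fun p => (C p.1).vtx p.2
  have hnz : ∀ p, A (r p) (c p) ≠ 0 := fun p =>
    ((ends_iff h _ _ _).mp ((C p.1).ends_eq p.2)).2.1
  have hblk : ∀ p q, A (r p) (c q) ≠ 0 → p.1 = q.1 := by
    intro p q hpq
    by_contra hne
    exact Set.disjoint_left.mp (hdisj _ _ hne) (cycle_nz h (C p.1) p.2 _ hpq) ⟨q.2, rfl⟩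
  have hc : Function.Injective c := by
    rintro ⟨t, a⟩ ⟨t', b⟩ hab
    obtain rfl : t = t' := by
      by_contra hne
      exact Set.disjoint_left.mp (hdisj _ _ hne) ⟨a, rfl⟩ ⟨b, hab.symm⟩
    have := (C t).vtx_inj hab
    simp only at this
    rw [this]
  have hr : Function.Injective r := by
    rintro ⟨t, a⟩ ⟨t', b⟩ hab
    obtain rfl : t = t' := hblk ⟨t, a⟩ ⟨t', b⟩ (by rw [hab]; exact hnz _)
    have := (C t).edge_inj hab
    simp only at this
    rw [this]
  refine le_trans ?_ (tdm_fintype ht r c hr hc)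
  have hbt : (A.submatrix r c).BlockTriangular Sigma.fst := by
    intro p q hpq
    by_contra hne
    exact absurd (hblk p q hne) (ne_of_gt hpq)
  rw [hbt.det_fintype]
  have : ∀ M : Fin k → ℤ, (∏ t, M t).natAbs = ∏ t, (M t).natAbs :=
    fun M => map_prod Int.natAbsHom _ _
  rw [this]
  calc 2 ^ k = ∏ t : Fin k, 2 := by simp
    _ ≤ _ := Finset.prod_le_prod' fun t _ => ?_
  let e : Fin (C t).n ≃ {p : (Σ t : Fin k, Fin (C t).n) // p.1 = t} :=
    { toFun := fun a => ⟨⟨t, a⟩, rfl⟩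
      invFun := fun p => p.2 ▸ p.1.2
      left_inv := fun a => rfl
      right_inv := by rintro ⟨⟨t', a⟩, rfl⟩; rfl }
  have hd := cycle_det h (C t) (hodd t)
  rw [← Matrix.det_submatrix_equiv_self e]
  exact hd

lemma packing_card {G : MGraph} {k : ℕ} (C : Fin k → G.Cycle)
    (hdisj : ∀ i j, i ≠ j → Disjoint ((C i).support) ((C j).support)) : k ≤ Nat.card G.V := by
  have hinj : Function.Injective (fun i => (C i).vtx ⟨0, (C i).npos⟩) := by
    intro i j hij
    by_contra hne
    exact Set.disjoint_left.mp (hdisj _ _ hne) ⟨_, rfl⟩ ⟨_, hij.symm⟩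
  simpa using Nat.card_le_card_of_injective _ hinj

lemma packing_bdd (G : MGraph) (γ : G.E → ZMod 2) : BddAbove {k : ℕ | ∃ C : Fin k → G.Cycle,
    (∀ i, (C i).parity γ = 1) ∧
    ∀ i j, i ≠ j → Disjoint ((C i).support) ((C j).support)} :=
  ⟨Nat.card G.V, fun _ ⟨C, _, hd⟩ => packing_card C hd⟩

lemma part3 {m n : ℕ} {A : Matrix (Fin m) (Fin n) ℤ} (h : TwoNonzeroPerRow A) {Δ : ℕ}
    (ht : TotallyDeltaModular A Δ) :
    (((matrixGraph A h).OCP (fun e => matrixSign A e) : ℕ) : ℝ) ≤ Real.logb 2 (Δ : ℝ) := by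
  apply two_pow_le_logb
  have hmem := Nat.sSup_mem (s := {k : ℕ | ∃ C : Fin k → (matrixGraph A h).Cycle,
    (∀ i, (C i).parity (fun e => matrixSign A e) = 1) ∧
    ∀ i j, i ≠ j → Disjoint ((C i).support) ((C j).support)})
    ⟨0, Fin.elim0, fun i => i.elim0, fun i => i.elim0⟩ (packing_bdd _ _)
  obtain ⟨C, h1, h2⟩ := hmem
  exact packing_le h ht C h1 h2

open Classical in
/-- Column weight. -/
noncomputable def colW {m n : ℕ} (A : Matrix (Fin m) (Fin n) ℤ) (v : Fin n) : ℕ :=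
  if v ∈ matrixRoots A then maxAbsEntry A else 1

lemma entry_le_colW {m n : ℕ} (A : Matrix (Fin m) (Fin n) ℤ) (i v) :
    (A i v).natAbs ≤ colW A v := by
  unfold colW
  split_ifs with hv
  · exact le_maxAbs A i v
  · by_contra hc
    exact hv ⟨i, by omega⟩

lemma orbit_exists {ι : Type} [Finite ι] [Nonempty ι] (f : ι → ι) :
    ∃ (k : ℕ) (g : Fin (k + 1) → ι), Function.Injective g ∧ ∀ i, f (g i) = g (i + 1) := by
  obtain ⟨i0⟩ := ‹Nonempty ι›
  have hper : ∃ x, x ∈ Function.periodicPts f := by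
    obtain ⟨a, b, hne, hab⟩ :=
      Finite.exists_ne_map_eq_of_infinite (fun t : ℕ => f^[t] i0)
    wlog hlt : a < b generalizing a b
    · exact this b a hne.symm hab.symm (by omega)
    refine ⟨f^[a] i0, b - a, by omega, ?_⟩
    rw [Function.IsPeriodicPt, Function.IsFixedPt, ← Function.iterate_add_apply,
      Nat.sub_add_cancel hlt.le, ← hab]
  obtain ⟨x, hx⟩ := hper
  have hpos := Function.minimalPeriod_pos_of_mem_periodicPts hx
  obtain ⟨k, hk⟩ : ∃ k, Function.minimalPeriod f x = k + 1 :=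
    ⟨Function.minimalPeriod f x - 1, by omega⟩
  refine ⟨k, fun i => f^[i.1] x, ?_, ?_⟩
  · intro i j hij
    apply Fin.ext
    exact (Function.iterate_eq_iterate_iff_of_lt_minimalPeriod (by omega) (by omega)).mp hij
  · intro i
    simp only
    rw [← Function.iterate_succ_apply' f, ← Function.iterate_mod_minimalPeriod_eq (n := i.1.succ),
      hk, fin_succ_val]

lemma key {m n : ℕ} {A : Matrix (Fin m) (Fin n) ℤ} (h : TwoNonzeroPerRow A) (N : ℕ) :
    ∀ (ι : Type) [Fintype ι] [DecidableEq ι] (r : ι → Fin m) (c : ι → Fin n),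
    Function.Injective r → Function.Injective c → Fintype.card ι = N →
    (∀ i, A (r i) (c i) ≠ 0) →
    ∃ (k : ℕ) (C : Fin k → (matrixGraph A h).Cycle),
      (∀ t, (C t).parity (fun e => matrixSign A e) = 1) ∧
      (∀ t t', t ≠ t' → Disjoint ((C t).support) ((C t').support)) ∧
      (∀ t, (C t).support ⊆ Set.range c) ∧
      (A.submatrix r c).det.natAbs ≤ 2 ^ k * ∏ i, colW A (c i) := by
  induction N using Nat.strong_induction_on with
  | _ N IH =>
  intro ι _ _ r c hr hc hN hdiag
  rcases isEmpty_or_nonempty ι with hemp | hne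
  · exact ⟨0, Fin.elim0, fun t => t.elim0, fun t => t.elim0, fun t => t.elim0, by simp⟩
  have hf : ∀ i, ∃ j, A (r i) (c j) ≠ 0 ∧ ∀ j', A (r i) (c j') ≠ 0 → j' = i ∨ j' = j := by
    intro i
    by_cases hex : ∃ j, j ≠ i ∧ A (r i) (c j) ≠ 0
    · obtain ⟨j, hji, hj⟩ := hex
      refine ⟨j, hj, fun j' hj' => ?_⟩
      rcases row_nz h (fun hh => hji (hc hh).symm) (hdiag i) hj hj' with hh | hh
      · exact Or.inl (hc hh)
      · exact Or.inr (hc hh)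
    · push Not at hex
      refine ⟨i, hdiag i, fun j' hj' => ?_⟩
      by_contra hcc
      exact hj' (hex j' (by tauto))
  choose f hf1 hf2 using hf
  obtain ⟨k, g, hg, hfg⟩ := orbit_exists f
  classical
  obtain ⟨p, hp⟩ : ∃ p : ι → Prop, ∀ i, p i ↔ i ∈ Set.range g := ⟨_, fun _ => Iff.rfl⟩
  have hdet := Matrix.twoBlockTriangular_det' (A.submatrix r c) p (by
    intro i0 hi0 j hj
    obtain ⟨i, rfl⟩ := (hp i0).mp hi0
    rw [hp] at hj
    by_contra hne
    rcases hf2 _ _ hne with rfl | rfl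
    · exact hj ⟨i, rfl⟩
    · exact hj ⟨i + 1, (hfg i).symm⟩)
  have hprod : (∏ i : {i // p i}, colW A (c i.1)) * (∏ i : {i // ¬ p i}, colW A (c i.1)) =
      ∏ i, colW A (c i) := Fintype.prod_subtype_mul_prod_subtype p (fun i => colW A (c i))
  obtain ⟨k', C, hC1, hC2, hC3, hC4⟩ := IH (Fintype.card {i // ¬ p i})
    (by
      rw [← hN]
      exact Fintype.card_subtype_lt (x := g 0) (fun hh => hh ((hp _).mpr ⟨0, rfl⟩)))
    {i // ¬ p i} (fun i => r i.1) (fun i => c i.1) (hr.comp Subtype.val_injective)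
    (hc.comp Subtype.val_injective) rfl (fun i => hdiag i.1)
  have hrest : (Matrix.toSquareBlockProp (A.submatrix r c) (fun i => ¬ p i)).det.natAbs ≤
      2 ^ k' * ∏ i : {i // ¬ p i}, colW A (c i.1) := hC4
  let e : Fin (k + 1) ≃ {i // p i} := Equiv.ofBijective
    (fun a => ⟨g a, (hp _).mpr ⟨a, rfl⟩⟩)
    ⟨fun a b hab => hg (congrArg Subtype.val hab), fun ⟨i, hi⟩ => by
      obtain ⟨a, rfl⟩ := (hp i).mp hi
      exact ⟨a, rfl⟩⟩
  have hblk : (Matrix.toSquareBlockProp (A.submatrix r c) p).det =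
      (A.submatrix (r ∘ g) (c ∘ g)).det := by
    rw [← Matrix.det_submatrix_equiv_self e]
    rfl
  have hw : ∏ i : {i // p i}, colW A (c i.1) = ∏ i, colW A (c (g i)) :=
    (Equiv.prod_comp e fun i : {i // p i} => colW A (c i.1)).symm
  have hdn : (A.submatrix r c).det.natAbs =
      (A.submatrix (r ∘ g) (c ∘ g)).det.natAbs *
      (Matrix.toSquareBlockProp (A.submatrix r c) (fun i => ¬ p i)).det.natAbs := by
    rw [hdet, Int.natAbs_mul, hblk]
  rw [hdn, ← hprod, hw]
  have hnz1 : ∀ i, A ((r ∘ g) i) ((c ∘ g) i) ≠ 0 := fun i => hdiag _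
  have hnz2 : ∀ i, A ((r ∘ g) i) ((c ∘ g) (i + 1)) ≠ 0 := fun i => by
    have := hf1 (g i)
    rw [hfg] at this
    exact this
  have hp1 : ∏ i, (A ((r ∘ g) i) ((c ∘ g) i)).natAbs ≤ ∏ i, colW A (c (g i)) :=
    Finset.prod_le_prod' fun i _ => entry_le_colW A _ _
  have hp2 : ∏ i, (A ((r ∘ g) i) ((c ∘ g) (i + 1))).natAbs ≤ ∏ i, colW A (c (g i)) := by
    rw [← Equiv.prod_comp (Equiv.addRight (1 : Fin (k + 1))) fun i => colW A (c (g i))]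
    exact Finset.prod_le_prod' fun i _ => entry_le_colW A _ _
  have hsubset : ∀ t, (C t).support ⊆ Set.range c := fun t v hv => by
    obtain ⟨i, rfl⟩ := hC3 t hv
    exact ⟨i.1, rfl⟩
  -- the easy outcome: the block contributes no factor two
  have easy : (A.submatrix (r ∘ g) (c ∘ g)).det.natAbs ≤ ∏ i, colW A (c (g i)) →
      ∃ (k : ℕ) (C : Fin k → (matrixGraph A h).Cycle),
      (∀ t, (C t).parity (fun e => matrixSign A e) = 1) ∧
      (∀ t t', t ≠ t' → Disjoint ((C t).support) ((C t').support)) ∧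
      (∀ t, (C t).support ⊆ Set.range c) ∧
      (A.submatrix (r ∘ g) (c ∘ g)).det.natAbs *
      (Matrix.toSquareBlockProp (A.submatrix r c) (fun i => ¬ p i)).det.natAbs ≤
      2 ^ k * ((∏ i, colW A (c (g i))) * ∏ i : {i // ¬ p i}, colW A (c i.1)) := by
    intro hle
    refine ⟨k', C, hC1, hC2, hsubset, ?_⟩
    calc _ ≤ _ := Nat.mul_le_mul hle hrest
      _ = _ := by ring
  rcases Nat.eq_zero_or_pos k with rfl | hk
  · apply easy
    rw [Matrix.det_fin_one]
    simpa using entry_le_colW A (r (g 0)) (c (g 0))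
  obtain ⟨ho, hev⟩ := cyc_core h hk (c ∘ g) (r ∘ g) (hc.comp hg) hnz1 hnz2
  by_cases hpar : ∑ i, matrixSign A ((r ∘ g) i) = 1
  · let D : (matrixGraph A h).Cycle :=
      { n := k + 1
        npos := Nat.succ_pos k
        vtx := c ∘ g
        edge := r ∘ g
        vtx_inj := hc.comp hg
        edge_inj := hr.comp hg
        ends_eq := fun i => by
          have hs : (⟨(i.1 + 1) % (k + 1), Nat.mod_lt _ (Nat.succ_pos k)⟩ : Fin (k + 1)) =
              i + 1 := by
            apply Fin.ext
            exact (fin_succ_val i).symm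
          rw [hs]
          refine (ends_iff h _ _ _).mpr ⟨fun hh => ?_, hnz1 i, hnz2 i⟩
          have h0 := (hc.comp hg) hh
          exact fin_one_ne hk (by simpa using h0) }
    have hDC : ∀ t, Disjoint D.support (C t).support := by
      intro t
      rw [Set.disjoint_left]
      rintro _ ⟨i, rfl⟩ hv
      obtain ⟨j, hj⟩ := hC3 t hv
      exact j.2 ((hp _).mpr ⟨i, (hc hj).symm⟩)
    refine ⟨k' + 1, Fin.cons D C, ?_, ?_, ?_, ?_⟩
    · intro t
      refine Fin.cases ?_ (fun t => ?_) t
      · exact hpar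
      · exact hC1 t
    · intro t t'
      refine Fin.cases ?_ (fun t => ?_) t <;> refine Fin.cases ?_ (fun t' => ?_) t'
      · exact fun hh => absurd rfl hh
      · exact fun _ => hDC t'
      · exact fun _ => (hDC t).symm
      · exact fun hh => hC2 t t' (fun h => hh (by rw [h]))
    · intro t
      refine Fin.cases ?_ (fun t => ?_) t
      · rintro _ ⟨i, rfl⟩
        exact ⟨g i, rfl⟩
      · exact hsubset t
    · have hle : (A.submatrix (r ∘ g) (c ∘ g)).det.natAbs ≤ 2 * ∏ i, colW A (c (g i)) := by
        rw [ho hpar]; omega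
      calc _ ≤ _ := Nat.mul_le_mul hle hrest
        _ = _ := by ring
  · exact easy ((hev hpar).trans (max_le hp1 hp2))

lemma part4 {m n : ℕ} {A : Matrix (Fin m) (Fin n) ℤ} (h : TwoNonzeroPerRow A)
    {s : ℕ} (r : Fin s → Fin m) (c : Fin s → Fin n)
    (hr : Function.Injective r) (hc : Function.Injective c) :
    (A.submatrix r c).det.natAbs ≤ 2 ^ ((matrixGraph A h).OCP (fun e => matrixSign A e)) *
        (maxAbsEntry A) ^ ((matrixRoots A).ncard) := by
  classical
  by_cases h0 : (A.submatrix r c).det = 0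
  · simp [h0]
  have hσ : ∃ σ : Equiv.Perm (Fin s), ∀ i, A (r (σ i)) (c i) ≠ 0 := by
    by_contra hcon
    push Not at hcon
    apply h0
    rw [Matrix.det_apply']
    refine Finset.sum_eq_zero fun σ _ => ?_
    obtain ⟨i, hi⟩ := hcon σ
    exact mul_eq_zero_of_right _ (Finset.prod_eq_zero (Finset.mem_univ i) hi)
  obtain ⟨σ, hσ⟩ := hσ
  obtain ⟨k, C, h1, h2, -, h4⟩ := key h s (Fin s) (r ∘ σ) c (hr.comp σ.injective) hc
    (Fintype.card_fin s) hσ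
  have hd : (A.submatrix (r ∘ σ) c).det.natAbs = (A.submatrix r c).det.natAbs := by
    have := Matrix.det_permute σ (A.submatrix r c)
    rw [Matrix.submatrix_submatrix, Function.comp_id] at this
    rw [this, Int.natAbs_mul]
    rcases Int.units_eq_one_or (Equiv.Perm.sign σ) with hh | hh <;> simp [hh]
  rw [← hd]
  refine h4.trans (Nat.mul_le_mul ?_ ?_)
  · exact Nat.pow_le_pow_right (by norm_num) (le_csSup (packing_bdd _ _) ⟨C, h1, h2⟩)
  · have e1 : ∏ i, colW A (c i) = ∏ v ∈ Finset.univ.image c, colW A v :=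
      (Finset.prod_image (fun a _ b _ hab => hc hab)).symm
    have hone : ∀ v, 1 ≤ colW A v := by
      intro v
      unfold colW
      split_ifs with hv
      · obtain ⟨i, hi⟩ := hv
        have := le_maxAbs A i v
        omega
      · exact le_rfl
    rw [e1]
    calc _ ≤ ∏ v, colW A v :=
          Finset.prod_le_prod_of_subset_of_one_le' (Finset.subset_univ _) fun v _ _ => hone v
      _ = _ := by
        unfold colW
        rw [Finset.prod_ite, Finset.prod_const, Finset.prod_const_one, mul_one,
          Set.ncard_eq_toFinset_card']
        congr 2
        ext; simp

end Aux



/-- Total `Δ`-modularity of a matrix with two nonzero entries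
per row, in terms of its rooted signed graph: if `A` is totally `Δ`-modular then
`‖A‖_∞ ≤ Δ`, `|K| ≤ 2 log₂ Δ` and `OCP(G,γ) ≤ log₂ Δ`; conversely, if `Δ` is the
largest absolute subdeterminant then `Δ ≤ 2^{OCP(G,γ)} ‖A‖_∞^{|K|}`. -/
theorem statement_19 (m n : ℕ) (A : Matrix (Fin m) (Fin n) ℤ)
    (h : TwoNonzeroPerRow A) :
    (∀ Δ : ℕ, TotallyDeltaModular A Δ →
      maxAbsEntry A ≤ Δ ∧
      ((matrixRoots A).ncard : ℝ) ≤ 2 * Real.logb 2 (Δ : ℝ) ∧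
      (((matrixGraph A h).OCP (fun e => matrixSign A e) : ℕ) : ℝ) ≤
        Real.logb 2 (Δ : ℝ)) ∧
    (∀ Δ : ℕ,
      IsGreatest {d : ℕ | ∃ (s : ℕ) (r : Fin s → Fin m) (c : Fin s → Fin n),
        Function.Injective r ∧ Function.Injective c ∧
        ((A.submatrix r c).det).natAbs = d} Δ →
      Δ ≤ 2 ^ ((matrixGraph A h).OCP (fun e => matrixSign A e)) *
        (maxAbsEntry A) ^ ((matrixRoots A).ncard)) := by
  refine ⟨fun Δ ht => ⟨part1 ht, part2 h ht, part3 h ht⟩, ?_⟩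
  rintro Δ ⟨⟨s, r, c, hr, hc, rfl⟩, -⟩
  exact part4 h r c hr hc

end TDMPaper
end
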